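/- arXiv:1402.1562 — 9 statements merged into one kernel-verified Lean document; each statement's English description precedes it below -/
import Mathlib

section
/- Let f: ℝ → ℝ be a Schwartz function. Then for every n ≥ 1, | (1/n) Σ_{x ∈ ℤ} f(x/n)² − ∫_ℝ f(x)² dx | ≤ (2/n) ‖f'‖_{L¹(ℝ)} ‖f‖_{L∞(ℝ)}. -/
open MeasureTheory

lemma aux_cell (G G' : ℝ → ℝ) (hd : ∀ x, HasDerivAt G (G' x) x) (hG' : Integrable G')
    (a : ℝ) : |G a - ∫ x in a..a + 1, G x| ≤ ∫ x in a..a + 1, |G' x| := by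
  have hc : Continuous G := continuous_iff_continuousAt.2 fun x => (hd x).continuousAt
  have h1 : G a - ∫ x in a..a + 1, G x = ∫ x in a..a + 1, (G a - G x) := by
    rw [intervalIntegral.integral_sub (by simp) (hc.intervalIntegrable _ _)]
    simp
  rw [h1]
  have := intervalIntegral.norm_integral_le_of_norm_le_const (a := a) (b := a + 1)
    (f := fun x => G a - G x) (C := ∫ x in a..a + 1, |G' x|) ?_
  · simpa using this
  · intro x hx
    rw [Set.uIoc_of_le (by linarith)] at hx
    have h2 : ∫ t in a..x, G' t = G x - G a :=
      intervalIntegral.integral_eq_sub_of_hasDerivAt (fun t _ => hd t) hG'.intervalIntegrable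
    rw [← neg_sub, norm_neg, ← h2]
    refine (intervalIntegral.norm_integral_le_integral_norm hx.1.le).trans ?_
    exact intervalIntegral.integral_mono_interval le_rfl hx.1.le hx.2
      (Filter.Eventually.of_forall fun t => abs_nonneg _) hG'.abs.intervalIntegrable

lemma aux_sum (G G' : ℝ → ℝ) (hd : ∀ x, HasDerivAt G (G' x) x) (hG : Integrable G)
    (hG' : Integrable G') :
    |∑' k : ℤ, G k - ∫ x, G x| ≤ ∫ x, |G' x| := by
  have s1 := hG.hasSum_intervalIntegral 0
  have s2 := hG'.abs.hasSum_intervalIntegral 0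
  simp only [zero_add] at s1 s2
  have hb : ∀ k : ℤ, ‖G k - ∫ x in (k : ℝ)..k + 1, G x‖ ≤ ∫ x in (k : ℝ)..k + 1, |G' x| :=
    fun k => aux_cell G G' hd hG' k
  have s3 : Summable fun k : ℤ => G k - ∫ x in (k : ℝ)..k + 1, G x :=
    Summable.of_norm_bounded s2.summable hb
  have s4 : Summable fun k : ℤ => G k := by
    simpa using s3.add s1.summable
  rw [← s1.tsum_eq, ← s4.tsum_sub s1.summable]
  exact tsum_of_norm_bounded s2 hb

theorem stmt_0 (f : SchwartzMap ℝ ℝ) (n : ℕ) (hn : 1 ≤ n) :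
    |(1 / (n : ℝ)) * ∑' x : ℤ, (f ((x : ℝ) / n)) ^ 2 - ∫ x : ℝ, (f x) ^ 2| ≤
      (2 / (n : ℝ)) * (∫ x : ℝ, |deriv (⇑f) x|) * (⨆ x : ℝ, |f x|) := by
  have hn0 : (0 : ℝ) < n := by exact_mod_cast hn
  have hbdd : BddAbove (Set.range fun x => |f x|) := by
    refine ⟨SchwartzMap.seminorm ℝ 0 0 f, ?_⟩
    rintro _ ⟨x, rfl⟩
    exact SchwartzMap.norm_le_seminorm ℝ f x
  set M := ⨆ x : ℝ, |f x| with hM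
  have hle : ∀ x, |f x| ≤ M := fun x => le_ciSup hbdd x
  have hf' : Integrable (deriv f) := (SchwartzMap.derivCLM ℝ ℝ f).integrable
  have hfc : Continuous f := f.continuous
  have hsq : Integrable fun x => f x ^ 2 := by
    have := (f.integrable (μ := volume)).bdd_mul (c := M) hfc.aestronglyMeasurable
      (Filter.Eventually.of_forall hle)
    simpa [pow_two] using this
  have hff : Integrable fun x => f x * deriv f x :=
    hf'.bdd_mul (c := M) hfc.aestronglyMeasurable (Filter.Eventually.of_forall hle)
  have hd : ∀ x : ℝ, HasDerivAt (fun x : ℝ => f (x / n) ^ 2)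
      (2 / n * (f (x / n) * deriv f (x / n))) x := by
    intro x
    have h1 : HasDerivAt f (deriv f (x / n)) (x / n) := (f.differentiableAt).hasDerivAt
    have h2 := (h1.comp x ((hasDerivAt_id x).div_const (n : ℝ))).pow 2
    refine h2.congr_deriv ?_
    simp
    ring
  have key := aux_sum _ _ hd (hsq.comp_div hn0.ne') ((hff.comp_div hn0.ne').const_mul _)
  rw [Measure.integral_comp_div (fun x => f x ^ 2)] at key
  have h3 : ∫ x : ℝ, |2 / n * (f (x / n) * deriv f (x / n))|
      ≤ 2 * (∫ x : ℝ, |deriv (⇑f) x|) * M := by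
    have h4 : ∫ x : ℝ, 2 / n * M * |deriv f (x / n)| = 2 * (∫ x : ℝ, |deriv (⇑f) x|) * M := by
      rw [integral_const_mul, Measure.integral_comp_div (fun x => |deriv f x|)]
      simp only [smul_eq_mul, abs_of_pos hn0]
      field_simp
    rw [← h4]
    refine integral_mono ((hff.comp_div hn0.ne').const_mul _).abs
      ((hf'.abs.comp_div hn0.ne').const_mul _) fun x => ?_
    simp only [abs_mul]
    rw [abs_of_pos (by positivity : (0 : ℝ) < 2 / n), mul_assoc]
    have := hle (x / n)
    gcongr
  have h5 := key.trans h3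
  simp only [smul_eq_mul, abs_of_pos hn0] at h5
  have h6 : (1 / (n : ℝ)) * ∑' x : ℤ, (f ((x : ℝ) / n)) ^ 2 - ∫ x : ℝ, (f x) ^ 2
      = (1 / n) * (∑' x : ℤ, (f ((x : ℝ) / n)) ^ 2 - n * ∫ x : ℝ, (f x) ^ 2) := by
    field_simp
  rw [h6, abs_mul, abs_of_pos (by positivity : (0 : ℝ) < 1 / n)]
  calc _ ≤ 1 / (n : ℝ) * (2 * (∫ x : ℝ, |deriv (⇑f) x|) * M) := by gcongr
    _ = _ := by ring
end

section
/- For every δ > 0 there exists a constant c > 0 such that ‖f_ℓ‖_{L¹(ℝ)} ≤ c (1+ℓ)^{(1+δ)/4} for every ℓ ∈ ℕ₀, where f_ℓ is the ℓ-th Hermite function. -/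
/-- The ℓ-th Hermite function `f_ℓ(x) = (ℓ! √(2π))^{-1/2} H_ℓ(x) e^{-x²/4}`, where `H_ℓ` is the
probabilists' Hermite polynomial. -/
noncomputable def hermiteFun (ℓ : ℕ) (x : ℝ) : ℝ :=
  (Real.sqrt (ℓ.factorial * Real.sqrt (2 * Real.pi)))⁻¹ *
    (Polynomial.aeval x (Polynomial.hermite ℓ)) * Real.exp (-x ^ 2 / 4)

open Polynomial MeasureTheory

noncomputable def hermR (n : ℕ) : ℝ[X] := (hermite n).map (Int.castRingHom ℝ)

noncomputable def gaussL (p : ℝ[X]) : ℝ := ∫ x : ℝ, p.eval x * Real.exp (-(1/2) * x ^ 2)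

lemma gauss_integrable (p : ℝ[X]) :
    Integrable (fun x : ℝ => p.eval x * Real.exp (-(1/2) * x ^ 2)) := by
  induction p using Polynomial.induction_on' with
  | add p q hp hq =>
    simp only [eval_add, add_mul]
    exact hp.add hq
  | monomial n a =>
    have h := integrable_rpow_mul_exp_neg_mul_sq (b := 1/2) (by norm_num) (s := (n : ℝ))
      (by have := Nat.cast_nonneg (α := ℝ) n; linarith)
    simp only [eval_monomial, mul_assoc]
    simp only [Real.rpow_natCast] at h
    exact h.const_mul a

lemma gaussL_add (p q : ℝ[X]) : gaussL (p + q) = gaussL p + gaussL q := by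
  unfold gaussL
  rw [← integral_add (gauss_integrable p) (gauss_integrable q)]
  simp only [eval_add, add_mul]

lemma gaussL_C (a : ℝ) (p : ℝ[X]) : gaussL (C a * p) = a * gaussL p := by
  unfold gaussL
  rw [← integral_const_mul]
  simp only [eval_mul, eval_C, mul_assoc]

lemma gaussL_X (p : ℝ[X]) : gaussL (X * p) = gaussL (derivative p) := by
  have hd : ∀ x : ℝ, HasDerivAt (fun x : ℝ => p.eval x * Real.exp (-(1/2) * x ^ 2))
      ((derivative p + C (-1) * (X * p)).eval x * Real.exp (-(1/2) * x ^ 2)) x := by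
    intro x
    have h1 := p.hasDerivAt x
    have h2 : HasDerivAt (fun x : ℝ => -(1/2) * x ^ 2) (-(1/2) * (2 * x)) x := by
      simpa using (hasDerivAt_pow 2 x).const_mul (-(1/2) : ℝ)
    refine (h1.mul h2.exp).congr_deriv ?_
    simp only [eval_add, eval_mul, eval_C, eval_X]
    ring
  have h := integral_eq_zero_of_hasDerivAt_of_integrable hd (gauss_integrable _)
    (gauss_integrable p)
  have h' : gaussL (derivative p + C (-1) * (X * p)) = 0 := h
  rw [gaussL_add, gaussL_C] at h'
  linarith

lemma gaussL_mono {p q : ℝ[X]} (h : ∀ x, p.eval x ≤ q.eval x) : gaussL p ≤ gaussL q := by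
  unfold gaussL
  apply integral_mono (gauss_integrable p) (gauss_integrable q)
  intro x
  exact mul_le_mul_of_nonneg_right (h x) (Real.exp_pos _).le

lemma hermR_succ (n : ℕ) : hermR (n + 1) = X * hermR n - derivative (hermR n) := by
  simp [hermR, hermite_succ, derivative_map]

lemma hermR_deriv (n : ℕ) : derivative (hermR (n + 1)) = C ((n : ℝ) + 1) * hermR n := by
  induction n with
  | zero => simp [hermR]
  | succ n ih =>
    rw [hermR_succ (n + 1), derivative_sub, derivative_mul, ih, hermR_succ n]
    simp
    ring

lemma gaussL_herm (n : ℕ) (q : ℝ[X]) :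
    gaussL (hermR (n + 1) * q) = gaussL (hermR n * derivative q) := by
  have e : hermR (n + 1) * q = X * (hermR n * q) + C (-1) * (derivative (hermR n) * q) := by
    rw [hermR_succ]; simp; ring
  rw [e, gaussL_add, gaussL_X, gaussL_C, derivative_mul, gaussL_add]
  ring

lemma gaussL_sq_succ (n : ℕ) :
    gaussL (hermR (n + 1) * hermR (n + 1)) = (n + 1) * gaussL (hermR n * hermR n) := by
  rw [gaussL_herm, hermR_deriv, ← gaussL_C]
  congr 1; ring

lemma gaussL_sq (n : ℕ) :
    gaussL (hermR n * hermR n) = n.factorial * Real.sqrt (2 * Real.pi) := by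
  induction n with
  | zero =>
    have := integral_gaussian (1/2)
    simp [gaussL, hermR]
    simp at this
    rw [this, mul_comm]
  | succ n ih =>
    rw [gaussL_sq_succ, ih, Nat.factorial_succ]; push_cast; ring

lemma gaussL_deriv_sq (n : ℕ) :
    gaussL (derivative (hermR n) * derivative (hermR n)) = n * gaussL (hermR n * hermR n) := by
  cases n with
  | zero => simp [gaussL, hermR]
  | succ n =>
    rw [gaussL_sq_succ, hermR_deriv]
    have e : C ((n : ℝ) + 1) * hermR n * (C ((n : ℝ) + 1) * hermR n) =
      C ((n : ℝ) + 1) * (C ((n : ℝ) + 1) * (hermR n * hermR n)) := by ring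
    rw [e, gaussL_C, gaussL_C]; push_cast; ring

lemma gaussL_X_sq (n : ℕ) :
    gaussL (X ^ 2 * (hermR n * hermR n)) ≤ 4 * (n + 1) * gaussL (hermR n * hermR n) := by
  have h : gaussL (X ^ 2 * (hermR n * hermR n)) ≤
      gaussL (C 2 * (hermR (n + 1) * hermR (n + 1)) +
        C 2 * (derivative (hermR n) * derivative (hermR n))) := by
    apply gaussL_mono
    intro x
    rw [hermR_succ]
    simp only [eval_mul, eval_add, eval_sub, eval_X, eval_C, eval_pow]
    nlinarith [sq_nonneg (x * (hermR n).eval x - 2 * (derivative (hermR n)).eval x)]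
  rw [gaussL_add, gaussL_C, gaussL_C, gaussL_sq_succ, gaussL_deriv_sq] at h
  have : 0 ≤ gaussL (hermR n * hermR n) := by rw [gaussL_sq]; positivity
  nlinarith

lemma hermiteFun_sq (n : ℕ) (x : ℝ) : hermiteFun n x ^ 2 =
    (n.factorial * Real.sqrt (2 * Real.pi))⁻¹ *
      ((hermR n * hermR n).eval x * Real.exp (-(1/2) * x ^ 2)) := by
  have e1 : Real.exp (-x ^ 2 / 4) ^ 2 = Real.exp (-(1/2) * x ^ 2) := by
    rw [← Real.exp_nat_mul]; congr 1; push_cast; ring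
  have e2 : aeval x (hermite n) = (hermR n).eval x := by
    rw [hermR, eval_map, aeval_def]; rfl
  unfold hermiteFun
  rw [mul_pow, mul_pow, e1, e2, inv_pow, Real.sq_sqrt (by positivity), eval_mul]
  ring

/-- For every `δ > 0` there is `c > 0` with
`‖f_ℓ‖_{L¹} ≤ c (1+ℓ)^{(1+δ)/4}` for all `ℓ`. -/
theorem stmt_1 (δ : ℝ) (hδ : 0 < δ) :
    ∃ c : ℝ, 0 < c ∧ ∀ ℓ : ℕ,
      (∫ x : ℝ, |hermiteFun ℓ x|) ≤ c * (1 + ℓ : ℝ) ^ ((1 + δ) / 4) := by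
  refine ⟨(5 + Real.pi) / 2, by positivity, fun n => ?_⟩
  have hn : (1 : ℝ) ≤ 1 + n := by have := Nat.cast_nonneg (α := ℝ) n; linarith
  set a : ℝ := (1 + n : ℝ) ^ ((1 : ℝ) / 4) with ha
  have ha0 : 0 < a := by positivity
  have ha4 : a ^ 4 = 1 + n := by
    rw [ha, ← Real.rpow_natCast, ← Real.rpow_mul (by linarith)]; norm_num
  have hle : a ≤ (1 + n : ℝ) ^ ((1 + δ) / 4) :=
    Real.rpow_le_rpow_of_exponent_le hn (by linarith)
  suffices h : (∫ x : ℝ, |hermiteFun n x|) ≤ (5 + Real.pi) / 2 * a from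
    h.trans (mul_le_mul_of_nonneg_left hle (by positivity))
  set N : ℝ := n.factorial * Real.sqrt (2 * Real.pi) with hN
  have hN0 : 0 < N := by positivity
  set q : ℝ[X] := hermR n * hermR n + C (a ^ 4)⁻¹ * (X ^ 2 * (hermR n * hermR n)) with hq
  have hLq : gaussL q ≤ 5 * N := by
    have h := gaussL_X_sq n
    rw [hq, gaussL_add, gaussL_C]
    rw [gaussL_sq] at h ⊢
    have h2 : (a ^ 4)⁻¹ * gaussL (X ^ 2 * (hermR n * hermR n)) ≤ 4 * N := by
      rw [inv_mul_le_iff₀ (by positivity), ha4]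
      linarith
    linarith
  have hI2 : Integrable (fun x : ℝ => (1 + (x / a ^ 2) ^ 2)⁻¹) :=
    integrable_inv_one_add_sq.comp_div (by positivity)
  have hI1 := (gauss_integrable q).const_mul (a / 2 * N⁻¹)
  have hI2' := hI2.const_mul (1 / (2 * a))
  have hint2 : (∫ x : ℝ, (1 + (x / a ^ 2) ^ 2)⁻¹) = a ^ 2 * Real.pi := by
    rw [Measure.integral_comp_div (fun y : ℝ => (1 + y ^ 2)⁻¹) (a ^ 2),
      integral_univ_inv_one_add_sq, abs_of_pos (by positivity), smul_eq_mul]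
  have hpt : ∀ x : ℝ, |hermiteFun n x| ≤
      a / 2 * N⁻¹ * (q.eval x * Real.exp (-(1/2) * x ^ 2)) +
        1 / (2 * a) * (1 + (x / a ^ 2) ^ 2)⁻¹ := by
    intro x
    have e : a / 2 * N⁻¹ * (q.eval x * Real.exp (-(1/2) * x ^ 2)) =
        a / 2 * ((1 + (x / a ^ 2) ^ 2) * |hermiteFun n x| ^ 2) := by
      rw [sq_abs, hermiteFun_sq, ← hN, hq]
      simp only [eval_add, eval_mul, eval_C, eval_pow, eval_X]
      field_simp
    rw [e]
    set t := |hermiteFun n x|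
    set w := 1 + (x / a ^ 2) ^ 2 with hw
    have hw0 : 0 < w := by positivity
    have : a / 2 * (w * t ^ 2) + 1 / (2 * a) * w⁻¹ - t = (a * w * t - 1) ^ 2 / (2 * a * w) := by
      field_simp; ring
    have h3 : 0 ≤ (a * w * t - 1) ^ 2 / (2 * a * w) := by positivity
    linarith
  calc (∫ x : ℝ, |hermiteFun n x|)
      ≤ ∫ x : ℝ, (a / 2 * N⁻¹ * (q.eval x * Real.exp (-(1/2) * x ^ 2)) +
        1 / (2 * a) * (1 + (x / a ^ 2) ^ 2)⁻¹) := by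
        apply integral_mono_of_nonneg (Filter.Eventually.of_forall fun x => abs_nonneg _)
          (hI1.add hI2') (Filter.Eventually.of_forall hpt)
    _ = a / 2 * N⁻¹ * gaussL q + 1 / (2 * a) * (a ^ 2 * Real.pi) := by
        rw [integral_add hI1 hI2', integral_const_mul, integral_const_mul, hint2]; rfl
    _ ≤ a / 2 * N⁻¹ * (5 * N) + 1 / (2 * a) * (a ^ 2 * Real.pi) := by gcongr
    _ = (5 + Real.pi) / 2 * a := by field_simp
end

section
/- For every δ > 0 there exists a constant c > 0 such that ‖f_ℓ'‖_{L¹(ℝ)} ≤ c (1+ℓ)^{3/4+δ} for every ℓ ∈ ℕ₀, where f_ℓ is the ℓ-th Hermite function and f_ℓ' its derivative. -/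
/-- Real Hermite polynomial. -/
noncomputable def hR (n : ℕ) : Polynomial ℝ := (Polynomial.hermite n).map (Int.castRingHom ℝ)

open Polynomial MeasureTheory

lemma hR_succ (n : ℕ) : hR (n+1) = X * hR n - derivative (hR n) := by
  simp [hR, hermite_succ, derivative_map]

lemma hR_zero : hR 0 = 1 := by simp [hR]

lemma hR_deriv (n : ℕ) : derivative (hR (n+1)) = C ((n:ℝ)+1) * hR n := by
  induction n with
  | zero => simp [hR_succ, hR_zero]
  | succ k ih =>
    have e : hR (k+1) = X * hR k - derivative (hR k) := hR_succ k
    rw [hR_succ (k+1), derivative_sub, derivative_mul, ih, derivative_mul, derivative_C, derivative_X]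
    push_cast
    simp only [map_add, map_one]
    linear_combination (-(C (k:ℝ)) - 1) * e

lemma hR_deriv' (n : ℕ) : derivative (hR n) = C (n:ℝ) * hR (n-1) := by
  cases n with
  | zero => simp [hR_zero]
  | succ k => simpa using hR_deriv k

lemma pint (p : ℝ[X]) {b : ℝ} (hb : 0 < b) :
    Integrable (fun x : ℝ => p.eval x * Real.exp (-b * x^2)) := by
  induction p using Polynomial.induction_on' with
  | add p q hp hq =>
    simp only [eval_add, add_mul]
    exact hp.add hq
  | monomial n a =>
    have := (integrable_rpow_mul_exp_neg_mul_sq hb (s := n)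
      (by have : (0:ℝ) ≤ n := n.cast_nonneg
          linarith)).const_mul a
    simpa [mul_assoc] using this

lemma ibp (n : ℕ) (p : ℝ[X]) :
    ∫ x : ℝ, (hR (n+1) * p).eval x * Real.exp (-(1/2) * x^2)
      = ∫ x : ℝ, (hR n * derivative p).eval x * Real.exp (-(1/2) * x^2) := by
  have hb : (0:ℝ) < 1/2 := by norm_num
  rw [← sub_eq_zero, ← integral_sub (pint _ hb) (pint _ hb), ← neg_eq_zero, ← integral_neg]
  refine integral_eq_zero_of_hasDerivAt_of_integrable
    (f := fun x => (hR n * p).eval x * Real.exp (-(1/2) * x^2)) ?_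
    ((pint _ hb).sub (pint _ hb)).neg (pint _ hb)
  intro x
  have h1 := (hR n * p).hasDerivAt x
  have h2 : HasDerivAt (fun x : ℝ => Real.exp (-(1/2) * x^2))
      (Real.exp (-(1/2) * x^2) * (-(1/2) * (2 * x))) x := by
    have := ((hasDerivAt_pow 2 x).const_mul (-(1/2):ℝ)).exp
    simpa using this
  refine (h1.mul h2).congr_deriv ?_
  simp only [hR_succ, derivative_mul, eval_mul, eval_sub, eval_add, eval_X]
  ring

lemma hnorm (n : ℕ) : ∫ x : ℝ, (hR n * hR n).eval x * Real.exp (-(1/2) * x^2)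
    = n.factorial * Real.sqrt (2 * Real.pi) := by
  induction n with
  | zero =>
    simp only [hR_zero, mul_one, eval_one, one_mul]
    rw [integral_gaussian]
    simp [div_eq_mul_inv, mul_comm]
  | succ k ih =>
    rw [ibp, hR_deriv]
    have : ∀ x : ℝ, (hR k * (C ((k:ℝ)+1) * hR k)).eval x * Real.exp (-(1/2) * x^2)
        = ((k:ℝ)+1) * ((hR k * hR k).eval x * Real.exp (-(1/2) * x^2)) := by
      intro x; simp only [eval_mul, eval_C]; ring
    simp only [this]
    rw [integral_const_mul, ih, Nat.factorial_succ]
    push_cast; ring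

lemma hF (n : ℕ) (x : ℝ) : hermiteFun n x =
    (Real.sqrt (n.factorial * Real.sqrt (2 * Real.pi)))⁻¹ * (hR n).eval x
      * Real.exp (-(1/4) * x^2) := by
  have : -x^2/4 = -(1/4) * x^2 := by ring
  rw [hermiteFun, this]
  simp [hR, eval_map, aeval_def]

lemma hFint (n : ℕ) : Integrable (hermiteFun n) := by
  have := (pint (hR n) (b := 1/4) (by norm_num)).const_mul
    ((Real.sqrt (n.factorial * Real.sqrt (2 * Real.pi)))⁻¹)
  refine this.congr (Filter.Eventually.of_forall fun x => ?_)
  simp only [hF]; ring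

lemma hFsq (n : ℕ) (x : ℝ) : hermiteFun n x ^ 2 = (n.factorial * Real.sqrt (2 * Real.pi))⁻¹ *
    ((hR n * hR n).eval x * Real.exp (-(1/2) * x^2)) := by
  have h : Real.exp (-(1/2) * x^2) = Real.exp (-(1/4) * x^2) ^ 2 := by
    rw [← Real.exp_nat_mul]; congr 1; push_cast; ring
  rw [hF, h, mul_pow, mul_pow, inv_pow, Real.sq_sqrt (by positivity), eval_mul]
  ring

lemma hFsq_int (n : ℕ) : Integrable (fun x => hermiteFun n x ^ 2) := by
  simp only [hFsq]
  exact (pint _ (by norm_num)).const_mul _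

lemma hFsq_one (n : ℕ) : ∫ x, hermiteFun n x ^ 2 = 1 := by
  simp only [hFsq]
  rw [integral_const_mul, hnorm]
  exact inv_mul_cancel₀ (by positivity)

/-- `x f_n = √(n+1) f_{n+1} + √n f_{n-1}` and the derivative, normalised. -/
lemma hF_up (n : ℕ) (x : ℝ) : Real.sqrt (n+1) * hermiteFun (n+1) x =
    (Real.sqrt (n.factorial * Real.sqrt (2 * Real.pi)))⁻¹ * (hR (n+1)).eval x
      * Real.exp (-(1/4) * x^2) := by
  rw [hF, Nat.factorial_succ]
  push_cast
  rw [mul_assoc ((n:ℝ)+1), Real.sqrt_mul (by positivity), mul_inv]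
  have : Real.sqrt ((n:ℝ)+1) ≠ 0 := by positivity
  field_simp

lemma hF_down (n : ℕ) (x : ℝ) : Real.sqrt n * hermiteFun (n-1) x =
    (Real.sqrt (n.factorial * Real.sqrt (2 * Real.pi)))⁻¹ * (n * (hR (n-1)).eval x)
      * Real.exp (-(1/4) * x^2) := by
  cases n with
  | zero => simp
  | succ n =>
    rw [hF, Nat.factorial_succ]
    push_cast
    rw [mul_assoc ((n:ℝ)+1), Real.sqrt_mul (show (0:ℝ) ≤ (n:ℝ)+1 by positivity), mul_inv]
    have h : Real.sqrt ((n:ℝ)+1) ≠ 0 := by positivity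
    have h2 : ((n:ℝ)+1) = Real.sqrt ((n:ℝ)+1) * Real.sqrt ((n:ℝ)+1) :=
      (Real.mul_self_sqrt (by positivity)).symm
    set s := Real.sqrt ((n:ℝ)+1)
    rw [show (n:ℝ)+1 = s * s from h2]
    field_simp

lemma hF_x (n : ℕ) (x : ℝ) : x * hermiteFun n x =
    Real.sqrt (n+1) * hermiteFun (n+1) x + Real.sqrt n * hermiteFun (n-1) x := by
  rw [hF_up, hF_down, hR_succ, hR_deriv', hF]
  simp only [eval_sub, eval_mul, eval_C, eval_X]
  ring

lemma hF_deriv (n : ℕ) (x : ℝ) : deriv (hermiteFun n) x =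
    (1/2) * (Real.sqrt n * hermiteFun (n-1) x - Real.sqrt (n+1) * hermiteFun (n+1) x) := by
  rw [hF_up, hF_down]
  have e : hermiteFun n = fun x => (Real.sqrt (n.factorial * Real.sqrt (2 * Real.pi)))⁻¹ *
      (hR n).eval x * Real.exp (-(1/4) * x^2) := funext (hF n)
  rw [e]
  have h2 : HasDerivAt (fun x : ℝ => Real.exp (-(1/4) * x^2))
      (Real.exp (-(1/4) * x^2) * (-(1/4) * (2 * x))) x := by
    have := ((hasDerivAt_pow 2 x).const_mul (-(1/4):ℝ)).exp
    simpa using this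
  have h := (((hR n).hasDerivAt x).const_mul
    ((Real.sqrt (n.factorial * Real.sqrt (2 * Real.pi)))⁻¹)).mul h2
  refine h.deriv.trans ?_
  rw [hR_succ, hR_deriv']
  simp only [eval_sub, eval_mul, eval_C, eval_X]
  ring

lemma hF_L1 (n : ℕ) : ∫ x, |hermiteFun n x| ≤ 5 * ((n:ℝ)+1) ^ (1/4:ℝ) := by
  set r : ℝ := ((n:ℝ)+1) ^ (1/4:ℝ) with hr
  have hn0 : (0:ℝ) ≤ n := n.cast_nonneg
  have hrpos : 0 < r := by positivity
  have hr4 : r ^ 4 = n + 1 := by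
    rw [hr, ← Real.rpow_natCast, ← Real.rpow_mul (by positivity)]; norm_num
  -- pointwise bound
  have hpt : ∀ x, |hermiteFun n x| ≤ (1/2) * (r⁻¹ * (1 + (x / r^2)^2)⁻¹) +
      (1/2) * (r * hermiteFun n x ^ 2 + r⁻¹^3 * (2 * (n+1) * hermiteFun (n+1) x ^ 2
        + 2 * n * hermiteFun (n-1) x ^ 2)) := by
    intro x
    have hx := hF_x n x
    have hx2 : (x * hermiteFun n x)^2 ≤ 2 * (n+1) * hermiteFun (n+1) x ^ 2
        + 2 * n * hermiteFun (n-1) x ^ 2 := by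
      rw [hx]
      have h1 := Real.sq_sqrt (show (0:ℝ) ≤ n + 1 by positivity)
      have h2 := Real.sq_sqrt hn0
      nlinarith [sq_nonneg (Real.sqrt (n+1) * hermiteFun (n+1) x
        - Real.sqrt n * hermiteFun (n-1) x)]
    have h3 : |hermiteFun n x| ≤ (1/2) * (r⁻¹ * (1 + (x / r^2)^2)⁻¹) +
        (1/2) * (r * (1 + (x / r^2)^2) * hermiteFun n x ^ 2) := by
      set u := 1 + (x / r^2)^2 with hu
      have hupos : 0 < u := by positivity
      set g := |hermiteFun n x|
      have : hermiteFun n x ^ 2 = g^2 := (sq_abs _).symm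
      rw [this]
      have h4 : (1/2) * (r⁻¹ * u⁻¹) + (1/2) * (r * u * g ^ 2) - g
          = (1/2) * (r⁻¹ * u⁻¹) * (1 - r * u * g)^2 := by field_simp; ring
      have : 0 ≤ (1/2) * (r⁻¹ * u⁻¹) * (1 - r * u * g)^2 := by positivity
      linarith
    have h5 : r * (1 + (x / r^2)^2) * hermiteFun n x ^ 2
        = r * hermiteFun n x ^ 2 + r⁻¹^3 * (x * hermiteFun n x)^2 := by field_simp
    rw [h5] at h3
    have : r⁻¹^3 * (x * hermiteFun n x)^2 ≤ r⁻¹^3 * (2 * (n+1) * hermiteFun (n+1) x ^ 2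
        + 2 * n * hermiteFun (n-1) x ^ 2) := mul_le_mul_of_nonneg_left hx2 (by positivity)
    linarith
  have i1 : Integrable (fun x : ℝ => (1/2) * (r⁻¹ * (1 + (x / r^2)^2)⁻¹)) :=
    ((integrable_inv_one_add_sq.comp_div (by positivity)).const_mul _).const_mul _
  have j1 := (hFsq_int n).const_mul r
  have j2 := (hFsq_int (n+1)).const_mul (2 * ((n:ℝ)+1))
  have j3 := (hFsq_int (n-1)).const_mul (2 * (n:ℝ))
  have j4 : Integrable (fun x => r⁻¹^3 * (2 * ((n:ℝ)+1) * hermiteFun (n+1) x ^ 2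
        + 2 * n * hermiteFun (n-1) x ^ 2)) := (j2.add j3).const_mul (r⁻¹^3)
  have i2 := (j1.add ((j2.add j3).const_mul (r⁻¹^3))).const_mul (1/2)
  have hle := integral_mono (hFint n).abs (i1.add i2) hpt
  refine hle.trans ?_
  have v1 : ∫ x : ℝ, (1/2) * (r⁻¹ * (1 + (x / r^2)^2)⁻¹) = (1/2) * (r⁻¹ * (r^2 * Real.pi)) := by
    rw [integral_const_mul, integral_const_mul,
      Measure.integral_comp_div (fun x : ℝ => (1 + x^2)⁻¹), integral_univ_inv_one_add_sq,
      abs_of_pos (by positivity), smul_eq_mul]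
  have v2 : ∫ x : ℝ, (1/2) * (r * hermiteFun n x ^ 2 + r⁻¹^3 * (2 * (n+1) * hermiteFun (n+1) x ^ 2
        + 2 * n * hermiteFun (n-1) x ^ 2)) = (1/2) * (r + r⁻¹^3 * (2 * (n+1) + 2 * n)) := by
    rw [integral_const_mul, integral_add j1 j4, integral_const_mul,
      integral_const_mul, integral_add j2 j3, integral_const_mul, integral_const_mul,
      hFsq_one, hFsq_one, hFsq_one]
    ring
  have v := integral_add i1 i2
  refine (v.trans (congrArg₂ (· + ·) v1 v2)).le.trans ?_
  have h6 : r⁻¹^3 * (2 * (n+1) + 2 * n) ≤ r⁻¹^3 * (4 * r^4) :=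
    mul_le_mul_of_nonneg_left (by rw [hr4]; linarith) (by positivity)
  have h7 : r⁻¹^3 * (4 * r^4) = 4 * r := by field_simp
  have h8 : r⁻¹ * (r^2 * Real.pi) = r * Real.pi := by field_simp
  rw [h8]
  nlinarith [Real.pi_le_four]

/-- For every `δ > 0` there is `c > 0` with
`‖f_ℓ'‖_{L¹} ≤ c (1+ℓ)^{3/4+δ}` for all `ℓ`. -/
theorem stmt_2 (δ : ℝ) (hδ : 0 < δ) :
    ∃ c : ℝ, 0 < c ∧ ∀ ℓ : ℕ,
      (∫ x : ℝ, |deriv (hermiteFun ℓ) x|) ≤ c * (1 + ℓ : ℝ) ^ (3 / 4 + δ) := by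
  refine ⟨10, by norm_num, fun n => ?_⟩
  have hn0 : (0:ℝ) ≤ n := n.cast_nonneg
  set R : ℝ := ((n:ℝ)+1) ^ (1/4:ℝ) with hR'
  have hRpos : 0 < R := by positivity
  have hs : Real.sqrt (n+1) = R^2 := by
    rw [Real.sqrt_eq_rpow, hR', ← Real.rpow_natCast, ← Real.rpow_mul (by positivity)]; norm_num
  have hs' : Real.sqrt n ≤ R^2 := hs ▸ Real.sqrt_le_sqrt (by linarith)
  have a1 : ∫ x, |hermiteFun (n-1) x| ≤ 10 * R := by
    refine (hF_L1 (n-1)).trans ?_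
    have : (((n-1:ℕ):ℝ)+1) ^ (1/4:ℝ) ≤ R := by
      apply Real.rpow_le_rpow (by positivity) _ (by norm_num)
      have : ((n-1:ℕ):ℝ) ≤ n := by exact_mod_cast Nat.sub_le n 1
      linarith
    linarith
  have a2 : ∫ x, |hermiteFun (n+1) x| ≤ 10 * R := by
    refine (hF_L1 (n+1)).trans ?_
    have h1 : (((n+1:ℕ):ℝ)+1) ^ (1/4:ℝ) ≤ (2^4 * ((n:ℝ)+1)) ^ (1/4:ℝ) := by
      apply Real.rpow_le_rpow (by positivity) _ (by norm_num)
      push_cast; linarith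
    have h2 : ((2^4 : ℝ) * ((n:ℝ)+1)) ^ (1/4:ℝ) = 2 * R := by
      rw [Real.mul_rpow (by positivity) (by positivity), ← Real.rpow_natCast,
        ← Real.rpow_mul (by positivity)]
      norm_num [hR']
    linarith
  have i1 := ((hFint (n-1)).abs).const_mul (Real.sqrt n)
  have i2 := ((hFint (n+1)).abs).const_mul (Real.sqrt (n+1))
  have hle : ∫ x : ℝ, |deriv (hermiteFun n) x| ≤ ∫ x, (1/2) * (Real.sqrt n * |hermiteFun (n-1) x|
      + Real.sqrt (n+1) * |hermiteFun (n+1) x|) := by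
    refine integral_mono_of_nonneg (Filter.Eventually.of_forall fun x => abs_nonneg _)
      ((i1.add i2).const_mul _) (Filter.Eventually.of_forall fun x => ?_)
    simp only [hF_deriv]
    rw [abs_mul, abs_of_pos (by norm_num : (0:ℝ) < 1/2)]
    refine mul_le_mul_of_nonneg_left ((abs_sub _ _).trans ?_) (by norm_num)
    rw [abs_mul, abs_mul, abs_of_nonneg (Real.sqrt_nonneg _), abs_of_nonneg (Real.sqrt_nonneg _)]
  rw [integral_const_mul, integral_add i1 i2, integral_const_mul, integral_const_mul] at hle
  have b1 : Real.sqrt n * ∫ x, |hermiteFun (n-1) x| ≤ R^2 * (10 * R) :=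
    mul_le_mul hs' a1 (integral_nonneg fun x => abs_nonneg _) (by positivity)
  have b2 : Real.sqrt (n+1) * ∫ x, |hermiteFun (n+1) x| ≤ R^2 * (10 * R) :=
    mul_le_mul hs.le a2 (integral_nonneg fun x => abs_nonneg _) (by positivity)
  have hR3 : R^3 = (1 + n : ℝ) ^ (3/4 : ℝ) := by
    rw [hR', ← Real.rpow_natCast, ← Real.rpow_mul (by positivity), add_comm]; norm_num
  have hfin : R^3 ≤ (1 + n : ℝ) ^ (3/4 + δ) := by
    rw [hR3]
    exact Real.rpow_le_rpow_of_exponent_le (by linarith) (by linarith)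
  nlinarith
end

section
/- Let f: ℝ → ℝ be a smooth function of compact support and let j ∈ ℕ. Then Σ_{ℓ ∈ ℕ₀} (1+ℓ)^j ⟨f_ℓ, f⟩² ≤ ‖(∂_x − x/2)^j f‖²_{L²(ℝ)}, where (∂_x − x/2) denotes the operator sending g to the function x ↦ g'(x) − (x/2) g(x) and (∂_x − x/2)^j its j-th iterate. In particular, Σ_{ℓ ∈ ℕ₀} (1+ℓ)^{2k} ⟨f_ℓ, f⟩² < ∞ for every k ∈ ℝ. -/
/-- The operator `(∂_x − x/2)` sending `g` to `x ↦ g'(x) − (x/2) g(x)`. -/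
noncomputable def Dop (g : ℝ → ℝ) : ℝ → ℝ := fun x => deriv g x - x / 2 * g x

open Polynomial MeasureTheory

lemma hermite_derivative (n : ℕ) :
    derivative (hermite (n + 1)) = ((n : ℤ[X]) + 1) * hermite n := by
  induction n with
  | zero => simp
  | succ n ih =>
    rw [hermite_succ (n + 1), derivative_sub, derivative_mul, ih, hermite_succ n]
    simp only [derivative_X, derivative_mul, derivative_add, derivative_natCast, derivative_one]
    push_cast
    ring

lemma integrable_poly (p : ℤ[X]) :
    Integrable (fun x : ℝ => aeval x p * Real.exp (-x ^ 2 / 2)) := by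
  induction p using Polynomial.induction_on' with
  | add p q hp hq =>
    refine (hp.add hq).congr (Filter.Eventually.of_forall fun x => ?_)
    simp [add_mul]
  | monomial n a =>
    have h := (integrable_rpow_mul_exp_neg_mul_sq (b := 1 / 2) (by norm_num)
      (s := (n : ℝ)) (by have : (0 : ℝ) ≤ n := n.cast_nonneg
                         linarith)).const_mul (a : ℝ)
    refine h.congr (Filter.Eventually.of_forall fun x => ?_)
    simp only [Real.rpow_natCast, aeval_monomial]
    rw [show -(1 / 2) * x ^ 2 = -x ^ 2 / 2 by ring]
    simp [mul_assoc]

lemma integral_parts (p : ℤ[X]) (n : ℕ) :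
    ∫ x : ℝ, aeval x (p * hermite (n + 1)) * Real.exp (-x ^ 2 / 2) =
      ∫ x : ℝ, aeval x (derivative p * hermite n) * Real.exp (-x ^ 2 / 2) := by
  have hd : ∀ x : ℝ, HasDerivAt (fun x : ℝ => aeval x (p * hermite n) * Real.exp (-x ^ 2 / 2))
      (aeval x (derivative p * hermite n) * Real.exp (-x ^ 2 / 2)
        - aeval x (p * hermite (n + 1)) * Real.exp (-x ^ 2 / 2)) x := by
    intro x
    have h1 := (p * hermite n).hasDerivAt_aeval x
    have h2 : HasDerivAt (fun x : ℝ => Real.exp (-x ^ 2 / 2)) (Real.exp (-x ^ 2 / 2) * (-x)) x := by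
      have : HasDerivAt (fun x : ℝ => -x ^ 2 / 2) (-x) x := by
        have := ((hasDerivAt_id x).pow 2).neg.div_const 2
        exact this.congr_deriv (by simp; ring)
      exact this.exp
    refine (h1.mul h2).congr_deriv ?_
    rw [hermite_succ]
    simp only [derivative_mul, map_mul, map_add, map_sub, aeval_X]
    ring
  have h0 := integral_eq_zero_of_hasDerivAt_of_integrable hd
    ((integrable_poly _).sub (integrable_poly _)) (integrable_poly _)
  rw [integral_sub (integrable_poly _) (integrable_poly _)] at h0
  linarith

lemma hermite_orth (m n : ℕ) :
    ∫ x : ℝ, aeval x (hermite m * hermite n) * Real.exp (-x ^ 2 / 2) =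
      if m = n then (n.factorial : ℝ) * Real.sqrt (2 * Real.pi) else 0 := by
  have hz : ∀ n : ℕ,
      ∫ x : ℝ, aeval x (hermite 0 * hermite (n + 1)) * Real.exp (-x ^ 2 / 2) = 0 := by
    intro n
    rw [integral_parts]; simp
  induction n generalizing m with
  | zero =>
    cases m with
    | zero =>
      have := integral_gaussian (1 / 2)
      simp only [hermite_zero, map_one, mul_one, one_mul, if_true, Nat.factorial_zero, Nat.cast_one]
      rw [show (2 * Real.pi) = Real.pi / (1 / 2) by ring, ← this]
      congr 1; ext x; congr 1; ring
    | succ m =>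
      rw [mul_comm, hz]; simp
  | succ n ih =>
    cases m with
    | zero => rw [hz]; simp
    | succ m =>
      rw [integral_parts, hermite_derivative]
      have : ∀ x : ℝ, aeval x (((m : ℤ[X]) + 1) * hermite m * hermite n) * Real.exp (-x ^ 2 / 2)
          = ((m : ℝ) + 1) * (aeval x (hermite m * hermite n) * Real.exp (-x ^ 2 / 2)) := by
        intro x
        simp only [map_mul, map_add, map_natCast, map_one]; ring
      simp only [this]
      rw [integral_const_mul, ih]
      by_cases h : m = n
      · subst h
        simp [Nat.factorial_succ]; ring
      · simp [h]

/-- normalizing constant -/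
noncomputable def cN (l : ℕ) : ℝ := Real.sqrt (l.factorial * Real.sqrt (2 * Real.pi))

lemma cN_sq (l : ℕ) : cN l ^ 2 = l.factorial * Real.sqrt (2 * Real.pi) := by
  unfold cN; rw [Real.sq_sqrt]; positivity

lemma cN_pos (l : ℕ) : 0 < cN l := by
  unfold cN; positivity

lemma cN_succ (l : ℕ) : cN (l + 1) = Real.sqrt (l + 1) * cN l := by
  unfold cN
  rw [← Real.sqrt_mul (by positivity), Nat.factorial_succ]
  push_cast; congr 1; ring

lemma hermiteFun_mul (m n : ℕ) (x : ℝ) : hermiteFun m x * hermiteFun n x =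
    ((cN m)⁻¹ * (cN n)⁻¹) * (aeval x (hermite m * hermite n) * Real.exp (-x ^ 2 / 2)) := by
  have : Real.exp (-x ^ 2 / 2) = Real.exp (-x ^ 2 / 4) * Real.exp (-x ^ 2 / 4) := by
    rw [← Real.exp_add]; congr 1; ring
  rw [this, map_mul]; unfold hermiteFun cN; ring

lemma hermiteFun_integrable (m n : ℕ) :
    Integrable (fun x : ℝ => hermiteFun m x * hermiteFun n x) := by
  simp only [hermiteFun_mul]
  exact (integrable_poly _).const_mul _

lemma hermiteFun_orth (m n : ℕ) :
    ∫ x : ℝ, hermiteFun m x * hermiteFun n x = if m = n then 1 else 0 := by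
  simp only [hermiteFun_mul]
  rw [integral_const_mul, hermite_orth]
  by_cases h : m = n
  · subst h
    simp only [if_true]
    rw [← cN_sq]
    have := (cN_pos m).ne'
    field_simp
  · simp [h]

lemma hermiteFun_hasDerivAt (l : ℕ) (x : ℝ) : HasDerivAt (hermiteFun (l + 1))
    (Real.sqrt (l + 1) * hermiteFun l x - x / 2 * hermiteFun (l + 1) x) x := by
  have h1 := ((hermite (l + 1)).hasDerivAt_aeval x).const_mul (cN (l + 1))⁻¹
  have h2 : HasDerivAt (fun x : ℝ => Real.exp (-x ^ 2 / 4))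
      (Real.exp (-x ^ 2 / 4) * (-(x / 2))) x := by
    have : HasDerivAt (fun x : ℝ => -x ^ 2 / 4) (-(x / 2)) x := by
      have := ((hasDerivAt_id x).pow 2).neg.div_const 4
      exact this.congr_deriv (by simp; ring)
    exact this.exp
  have h3 := h1.mul h2
  have e1 : (cN (l + 1))⁻¹ * ((l : ℝ) + 1) = Real.sqrt (l + 1) * (cN l)⁻¹ := by
    have hs : Real.sqrt ((l : ℝ) + 1) ^ 2 = l + 1 := Real.sq_sqrt (by positivity)
    have hp : 0 < Real.sqrt ((l : ℝ) + 1) := by positivity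
    have := cN_pos l
    rw [cN_succ]
    field_simp
    linarith
  have e2 : Real.sqrt (l + 1) * hermiteFun l x - x / 2 * hermiteFun (l + 1) x =
      ((cN (l + 1))⁻¹ * aeval x (derivative (hermite (l + 1)))) * Real.exp (-x ^ 2 / 4) +
      ((cN (l + 1))⁻¹ * aeval x (hermite (l + 1))) * (Real.exp (-x ^ 2 / 4) * (-(x / 2))) := by
    rw [hermite_derivative]
    simp only [map_mul, map_add, map_natCast, map_one]
    have a : hermiteFun l x = (cN l)⁻¹ * aeval x (hermite l) * Real.exp (-x ^ 2 / 4) := rfl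
    have b : hermiteFun (l + 1) x =
      (cN (l + 1))⁻¹ * aeval x (hermite (l + 1)) * Real.exp (-x ^ 2 / 4) := rfl
    rw [a, b]
    linear_combination (-(aeval x (hermite l)) * Real.exp (-x ^ 2 / 4)) * e1
  rw [e2]
  exact h3

lemma hermiteFun_continuous (l : ℕ) : Continuous (hermiteFun l) := by
  unfold hermiteFun
  have := (hermite l).continuous_aeval (A := ℝ)
  fun_prop

lemma int_cs {f g : ℝ → ℝ} (hf : Continuous f) (hg : Continuous g) (hs : HasCompactSupport g) :
    Integrable (fun x => f x * g x) :=
  (hf.mul hg).integrable_of_hasCompactSupport hs.mul_left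

lemma inner_Dop (g : ℝ → ℝ) (hg : ContDiff ℝ (⊤ : ℕ∞) g) (hs : HasCompactSupport g) (l : ℕ) :
    ∫ x, hermiteFun (l + 1) x * Dop g x = - (Real.sqrt (l + 1) * ∫ x, hermiteFun l x * g x) := by
  have hgd : Continuous (deriv g) := hg.continuous_deriv (by simp)
  have i1 := int_cs (hermiteFun_continuous l) hg.continuous hs
  have i2 := int_cs (hermiteFun_continuous (l + 1)) hg.continuous hs
  have i3 : Integrable (fun x => hermiteFun (l + 1) x * Dop g x) := by
    have a := int_cs (hermiteFun_continuous (l + 1)) hgd hs.deriv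
    have b := int_cs (f := fun x => hermiteFun (l + 1) x * (x / 2))
      ((hermiteFun_continuous (l + 1)).mul (by fun_prop)) hg.continuous hs
    refine (a.sub b).congr (Filter.Eventually.of_forall fun x => ?_)
    simp only [Pi.sub_apply, Dop]; ring
  have hd : ∀ x, HasDerivAt (fun x => hermiteFun (l + 1) x * g x)
      (Real.sqrt (l + 1) * (hermiteFun l x * g x) + hermiteFun (l + 1) x * Dop g x) x := by
    intro x
    have h := (hermiteFun_hasDerivAt l x).mul (hg.differentiable (by simp) x).hasDerivAt
    refine h.congr_deriv ?_
    simp only [Dop]; ring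
  have h0 := integral_eq_zero_of_hasDerivAt_of_integrable hd ((i1.const_mul _).add i3) i2
  rw [integral_add (i1.const_mul _) i3, integral_const_mul] at h0
  linarith

lemma Dop_contDiff (g : ℝ → ℝ) (hg : ContDiff ℝ (⊤ : ℕ∞) g) : ContDiff ℝ (⊤ : ℕ∞) (Dop g) := by
  have h1 : ContDiff ℝ (⊤ : ℕ∞) (deriv g) := (contDiff_infty_iff_deriv.1 hg).2
  have h2 : ContDiff ℝ (⊤ : ℕ∞) (fun x : ℝ => x / 2 * g x) :=
    (contDiff_id.div_const 2).mul hg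
  exact h1.sub h2

lemma Dop_compact (g : ℝ → ℝ) (hs : HasCompactSupport g) : HasCompactSupport (Dop g) :=
  hs.deriv.sub (hs.mul_left (f := fun x : ℝ => x / 2))

lemma bessel (g : ℝ → ℝ) (hg : Continuous g) (hs : HasCompactSupport g) (s : Finset ℕ) :
    ∑ l ∈ s, (∫ x, hermiteFun l x * g x) ^ 2 ≤ ∫ x, g x ^ 2 := by
  set c : ℕ → ℝ := fun l => ∫ x, hermiteFun l x * g x with hc
  have ig : Integrable (fun x => g x ^ 2) := by simpa [sq] using int_cs hg hg hs
  have i1 : ∀ l, Integrable (fun x => hermiteFun l x * g x) := fun l =>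
    int_cs (hermiteFun_continuous l) hg hs
  have i2 : Integrable (fun x => ∑ l ∈ s, (2 * c l) * (hermiteFun l x * g x)) :=
    integrable_finsetSum _ fun l _ => (i1 l).const_mul _
  have i3 : ∀ l, Integrable
      (fun x => ∑ m ∈ s, (c l * c m) * (hermiteFun l x * hermiteFun m x)) := fun l =>
    integrable_finsetSum _ fun m _ => (hermiteFun_integrable l m).const_mul _
  have i4 : Integrable
      (fun x => ∑ l ∈ s, ∑ m ∈ s, (c l * c m) * (hermiteFun l x * hermiteFun m x)) :=
    integrable_finsetSum _ fun l _ => i3 l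
  have key : 0 ≤ ∫ x, (g x ^ 2 - (∑ l ∈ s, (2 * c l) * (hermiteFun l x * g x))
      + ∑ l ∈ s, ∑ m ∈ s, (c l * c m) * (hermiteFun l x * hermiteFun m x)) := by
    refine integral_nonneg fun x => ?_
    have e : g x ^ 2 - (∑ l ∈ s, (2 * c l) * (hermiteFun l x * g x))
      + ∑ l ∈ s, ∑ m ∈ s, (c l * c m) * (hermiteFun l x * hermiteFun m x)
      = (g x - ∑ l ∈ s, c l * hermiteFun l x) ^ 2 := by
      have e1 : ∑ l ∈ s, (2 * c l) * (hermiteFun l x * g x)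
          = 2 * g x * ∑ l ∈ s, c l * hermiteFun l x := by
        rw [Finset.mul_sum]; exact Finset.sum_congr rfl fun l _ => by ring
      have e2 : ∑ l ∈ s, ∑ m ∈ s, (c l * c m) * (hermiteFun l x * hermiteFun m x)
          = (∑ l ∈ s, c l * hermiteFun l x) * (∑ l ∈ s, c l * hermiteFun l x) := by
        rw [Finset.sum_mul_sum]
        exact Finset.sum_congr rfl fun l _ => Finset.sum_congr rfl fun m _ => by ring
      rw [e1, e2]; ring
    simp only [e]
    exact sq_nonneg _
  rw [integral_add (by exact ig.sub i2) i4, integral_sub ig i2,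
    integral_finsetSum _ (fun l _ => (i1 l).const_mul _),
    integral_finsetSum _ (fun l _ => i3 l)] at key
  have e3 : ∀ l ∈ s, ∫ x, ∑ m ∈ s, (c l * c m) * (hermiteFun l x * hermiteFun m x) = c l ^ 2 := by
    intro l hl
    rw [integral_finsetSum _ (fun m _ => (hermiteFun_integrable l m).const_mul _)]
    simp only [integral_const_mul, hermiteFun_orth]
    simp [hl, sq]
  have e4 : ∀ l ∈ s, ∫ x, (2 * c l) * (hermiteFun l x * g x) = 2 * c l ^ 2 := by
    intro l _
    rw [integral_const_mul, sq, ← mul_assoc]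
  rw [Finset.sum_congr rfl e3, Finset.sum_congr rfl e4, ← Finset.mul_sum] at key
  linarith

lemma main_aux (j : ℕ) : ∀ (f : ℝ → ℝ) (_ : ContDiff ℝ (⊤ : ℕ∞) f) (_ : HasCompactSupport f),
    (Summable fun ℓ : ℕ => (1 + ℓ : ℝ) ^ j * (∫ x : ℝ, hermiteFun ℓ x * f x) ^ 2) ∧
    (∑' ℓ : ℕ, (1 + ℓ : ℝ) ^ j * (∫ x : ℝ, hermiteFun ℓ x * f x) ^ 2 ≤
        ∫ x : ℝ, (Dop^[j] f x) ^ 2) := by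
  induction j with
  | zero =>
    intro f hf hs
    simp only [pow_zero, one_mul, Function.iterate_zero, id]
    have hb := bessel f hf.continuous hs
    have hsum := summable_of_sum_le (fun _ => sq_nonneg _) hb
    exact ⟨hsum, hsum.tsum_le_of_sum_le hb⟩
  | succ j ih =>
    intro f hf hs
    obtain ⟨h1, h2⟩ := ih (Dop f) (Dop_contDiff f hf) (Dop_compact f hs)
    have h3 := (summable_nat_add_iff 1).2 h1
    have hle : ∀ l : ℕ, (1 + l : ℝ) ^ (j + 1) * (∫ x : ℝ, hermiteFun l x * f x) ^ 2 ≤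
        (1 + ((l + 1 : ℕ) : ℝ)) ^ j * (∫ x : ℝ, hermiteFun (l + 1) x * Dop f x) ^ 2 := by
      intro l
      rw [inner_Dop f hf hs, neg_sq, mul_pow, Real.sq_sqrt (by positivity), pow_succ, mul_assoc,
        add_comm (l : ℝ) 1]
      gcongr
      simp
    have hsum : Summable fun l : ℕ =>
        (1 + l : ℝ) ^ (j + 1) * (∫ x : ℝ, hermiteFun l x * f x) ^ 2 :=
      Summable.of_nonneg_of_le (fun l => by positivity) hle h3
    refine ⟨hsum, (hsum.tsum_le_tsum hle h3).trans (le_trans ?_ h2)⟩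
    rw [h1.tsum_eq_zero_add]
    have : 0 ≤ (1 + ((0 : ℕ) : ℝ)) ^ j * (∫ x : ℝ, hermiteFun 0 x * Dop f x) ^ 2 := by positivity
    linarith

/-- For a smooth compactly supported `f : ℝ → ℝ` and `j ∈ ℕ`,
`∑_ℓ (1+ℓ)^j ⟨f_ℓ, f⟩² ≤ ‖(∂_x − x/2)^j f‖²_{L²}`; in particular
`∑_ℓ (1+ℓ)^{2k} ⟨f_ℓ, f⟩² < ∞` for every `k ∈ ℝ`. -/
theorem stmt_5 (f : ℝ → ℝ) (hf : ContDiff ℝ (⊤ : ℕ∞) f) (hsupp : HasCompactSupport f) (j : ℕ) :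
    (∑' ℓ : ℕ, (1 + ℓ : ℝ) ^ j * (∫ x : ℝ, hermiteFun ℓ x * f x) ^ 2 ≤
        ∫ x : ℝ, (Dop^[j] f x) ^ 2) ∧
      ∀ k : ℝ, Summable fun ℓ : ℕ =>
        (1 + ℓ : ℝ) ^ (2 * k) * (∫ x : ℝ, hermiteFun ℓ x * f x) ^ 2 := by
  refine ⟨(main_aux j f hf hsupp).2, fun k => ?_⟩
  obtain ⟨n, hn⟩ := exists_nat_ge (2 * k)
  refine Summable.of_nonneg_of_le (fun l => by positivity) (fun l => ?_) (main_aux n f hf hsupp).1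
  gcongr
  rw [← Real.rpow_natCast]
  exact Real.rpow_le_rpow_of_exponent_le (by simp) hn
end

section
/- Fix T > 0 and k < −1/2. Let 𝓗_k be the Hilbert space of real sequences a = (a_ℓ)_{ℓ ∈ ℕ₀} with ‖a‖²_{𝓗_k} = Σ_{ℓ ∈ ℕ₀} (1+ℓ)^{2k} a_ℓ² < ∞. A sequence {S^n}_{n ∈ ℕ} of elements of C([0,T]; 𝓗_k) (continuous paths with the uniform topology) is relatively compact provided: (i) for each ℓ ∈ ℕ₀ the family of real-valued functions {t ↦ S^n_t(ℓ)}_{n ∈ ℕ} is equicontinuous on [0,T], and (ii) sup { |S^n_t(ℓ)| : t ∈ [0,T], n ∈ ℕ, ℓ ∈ ℕ₀ } < ∞. -/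
/-- Fix `T > 0` and `k < −1/2`. The Hermite–Sobolev space `𝓗_k` of sequences
`a` with `∑_ℓ (1+ℓ)^{2k} a_ℓ² < ∞` is realized isometrically as `ℓ²(ℕ)` via the weighted
coordinates `b_ℓ = (1+ℓ)^k a_ℓ`, so that a path in `𝓗_k` is a path `S : C([0,T], ℓ²)` whose
`𝓗_k`-coordinates are `S_t(ℓ) = (1+ℓ)^{−k} b_ℓ`.  A sequence `{S^n}` in `C([0,T]; 𝓗_k)` is
relatively compact provided (i) for each `ℓ` the family `{t ↦ S^n_t(ℓ)}_n` is equicontinuous,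
and (ii) the set `{S^n_t(ℓ) : t, n, ℓ}` is bounded in `ℝ`. -/
theorem stmt_6 (T : ℝ) (hT : 0 < T) (k : ℝ) (hk : k < -(1 / 2))
    (S : ℕ → C(Set.Icc (0 : ℝ) T, lp (fun _ : ℕ => ℝ) 2))
    (hequi : ∀ ℓ : ℕ, Equicontinuous fun n : ℕ =>
      fun t : Set.Icc (0 : ℝ) T => ((1 : ℝ) + ℓ) ^ (-k) * (S n t : ∀ _ : ℕ, ℝ) ℓ)
    (hbdd : ∃ M : ℝ, ∀ (n : ℕ) (t : Set.Icc (0 : ℝ) T) (ℓ : ℕ),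
      |((1 : ℝ) + ℓ) ^ (-k) * (S n t : ∀ _ : ℕ, ℝ) ℓ| ≤ M) :
    IsCompact (closure (Set.range S)) := by
  obtain ⟨M, hM⟩ := hbdd
  have hpos : ∀ ℓ : ℕ, (0 : ℝ) < 1 + ℓ := fun ℓ => by positivity
  -- the square-summable weights
  have hw : Summable fun ℓ : ℕ => (((1 : ℝ) + ℓ) ^ k) ^ 2 := by
    have h1 : Summable fun n : ℕ => (n : ℝ) ^ (2 * k) :=
      Real.summable_nat_rpow.2 (by linarith)
    have h2 := (summable_nat_add_iff 1).2 h1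
    refine h2.congr fun ℓ => ?_
    rw [← Real.rpow_natCast, ← Real.rpow_mul (hpos ℓ).le]
    push_cast
    rw [add_comm (ℓ : ℝ) 1, mul_comm]
  have hmem : ∀ x : ℕ → Set.Icc (-M) M,
      Memℓp (E := fun _ : ℕ => ℝ) (fun ℓ : ℕ => ((1 : ℝ) + ℓ) ^ k * (x ℓ : ℝ)) 2 := by
    intro x
    apply memℓp_gen
    have : Summable fun ℓ : ℕ => (((1 : ℝ) + ℓ) ^ k) ^ 2 * M ^ 2 := hw.mul_right _
    refine Summable.of_nonneg_of_le (fun i => by positivity) (fun i => ?_) this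
    simp only [ENNReal.toReal_ofNat, Real.rpow_ofNat, Real.norm_eq_abs, sq_abs]
    rw [mul_pow]
    have h3 : (x i : ℝ) ^ 2 ≤ M ^ 2 := sq_le_sq' (x i).2.1 (x i).2.2
    gcongr
  let g : (ℕ → Set.Icc (-M) M) → lp (fun _ : ℕ => ℝ) 2 := fun x => ⟨_, hmem x⟩
  have hg : Continuous g := by
    rw [continuous_iff_continuousAt]
    intro y
    rw [ContinuousAt, tendsto_iff_norm_sub_tendsto_zero]
    have hc : Continuous fun x : ℕ → Set.Icc (-M) M =>
        ∑' ℓ : ℕ, (((1 : ℝ) + ℓ) ^ k) ^ 2 * ((x ℓ : ℝ) - y ℓ) ^ 2 := by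
      refine continuous_tsum (u := fun ℓ : ℕ => (((1 : ℝ) + ℓ) ^ k) ^ 2 * (2 * M) ^ 2)
        (fun i => by fun_prop) (hw.mul_right _) (fun i x => ?_)
      rw [Real.norm_of_nonneg (by positivity)]
      have h3 : ((x i : ℝ) - y i) ^ 2 ≤ (2 * M) ^ 2 :=
        sq_le_sq' (by linarith [(x i).2.1, (y i).2.2]) (by linarith [(x i).2.2, (y i).2.1])
      gcongr
    have hn : ∀ x, ‖g x - g y‖ =
        √(∑' ℓ : ℕ, (((1 : ℝ) + ℓ) ^ k) ^ 2 * ((x ℓ : ℝ) - y ℓ) ^ 2) := by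
      intro x
      rw [lp.norm_eq_tsum_rpow (by simp), Real.sqrt_eq_rpow]
      simp only [ENNReal.toReal_ofNat, Real.rpow_ofNat, Real.norm_eq_abs, sq_abs]
      congr 1
      refine tsum_congr fun ℓ => ?_
      rw [← mul_pow, mul_sub]
      rfl
    simp_rw [hn]
    have := (hc.sqrt).tendsto y
    simpa using this
  -- the unweighted coordinates
  let F : ℕ → Set.Icc (0 : ℝ) T → ℕ → Set.Icc (-M) M := fun n t ℓ =>
    ⟨((1 : ℝ) + ℓ) ^ (-k) * (S n t : ∀ _ : ℕ, ℝ) ℓ, abs_le.1 (hM n t ℓ)⟩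
  have hgF : ∀ n t, g (F n t) = S n t := by
    intro n t
    ext ℓ
    change ((1 : ℝ) + ℓ) ^ k * (((1 : ℝ) + ℓ) ^ (-k) * (S n t : ∀ _ : ℕ, ℝ) ℓ) = _
    rw [← mul_assoc, ← Real.rpow_add (hpos ℓ)]
    simp
  have hF : Equicontinuous F := by
    have h1 : ∀ ℓ : ℕ, Equicontinuous fun n t => F n t ℓ := by
      intro ℓ
      rw [isUniformEmbedding_subtype_val.isUniformInducing.equicontinuous_iff]
      exact hequi ℓ
    rw [Pi.uniformSpace_eq, equicontinuous_iInf_rng]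
    intro ℓ
    letI : UniformSpace (ℕ → Set.Icc (-M) M) :=
      UniformSpace.comap (fun a => a ℓ) inferInstance
    have hi : IsUniformInducing (fun a : ℕ → Set.Icc (-M) M => a ℓ) := ⟨rfl⟩
    exact hi.equicontinuous_iff.2 (h1 ℓ)
  have hR : (Set.range F).Equicontinuous := equicontinuous_iff_range.1 hF
  have hA : (closure (Set.range F)).Equicontinuous := hR.closure
  let K : Set C(Set.Icc (0 : ℝ) T, ℕ → Set.Icc (-M) M) :=
    {f | (f : Set.Icc (0 : ℝ) T → ℕ → Set.Icc (-M) M) ∈ closure (Set.range F)}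
  have hK : IsCompact K := by
    apply ArzelaAscoli.isCompact_of_equicontinuous
    · have : ContinuousMap.toFun '' K = closure (Set.range F) := by
        ext f
        constructor
        · rintro ⟨f, hf, rfl⟩
          exact hf
        · intro hf
          exact ⟨⟨f, hA.continuous ⟨f, hf⟩⟩, hf, rfl⟩
      rw [this]
      exact isClosed_closure.isCompact
    · exact hA.comp (fun f : K => ⟨f.1, f.2⟩)
  have hK' := hK.image (ContinuousMap.continuous_postcomp (⟨g, hg⟩ : C(_, _)))
  refine hK'.closure_of_subset ?_
  rintro _ ⟨n, rfl⟩
  refine ⟨⟨F n, hF.continuous n⟩, subset_closure ⟨n, rfl⟩, ?_⟩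
  ext1 t
  exact hgF n t
end

section
/- For every y ∈ (−1/2, 1/2] with y ≠ 0, the integral G(y) = (1/4) ∫_{−1/2}^{1/2} Ω(y−z, z)² / (Λ(y−z, z) − i Ω(y−z, z)) dz equals (1/4) · ((w−1)² / w²) · [1 − (2|sin(πy)|)^{−1/2} e^{−(iπ/2)(y − (1/2) sgn(y))}], where w = e^{2iπy}. -/
open Complex

/-- `Λ(u,v) = 4(sin²(πu) + sin²(πv))`. -/
noncomputable def Lam (u v : ℝ) : ℝ :=
  4 * (Real.sin (Real.pi * u) ^ 2 + Real.sin (Real.pi * v) ^ 2)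

/-- `Ω(u,v) = 2(sin(2πu) + sin(2πv))`. -/
noncomputable def Omg (u v : ℝ) : ℝ :=
  2 * (Real.sin (2 * Real.pi * u) + Real.sin (2 * Real.pi * v))

/-- `G(y) = (1/4) ∫_{−1/2}^{1/2} Ω(y−z,z)² / (Λ(y−z,z) − iΩ(y−z,z)) dz`. -/
noncomputable def Gfun (y : ℝ) : ℂ :=
  (1 / 4) * ∫ z in (-(1 / 2) : ℝ)..(1 / 2),
    ((Omg (y - z) z : ℂ) ^ 2) / ((Lam (y - z) z : ℂ) - I * (Omg (y - z) z : ℂ))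

lemma roots_norm (r : ℂ) (hr : 0 < r.re) (hw : ‖1 - r ^ 2‖ = 1) :
    ‖1 - r‖ < 1 ∧ 1 < ‖1 + r‖ := by
  have h1 : ‖1 - r‖ * ‖1 + r‖ = 1 := by
    rw [← norm_mul, ← hw]; congr 1; ring
  have h2 : ‖1 - r‖ ^ 2 < ‖1 + r‖ ^ 2 := by
    rw [Complex.sq_norm, Complex.sq_norm, normSq_apply, normSq_apply]
    simp
    nlinarith
  have h3 : ‖1 - r‖ < ‖1 + r‖ := lt_of_pow_lt_pow_left₀ 2 (norm_nonneg _) h2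
  have h4 := norm_nonneg (1 - r)
  constructor <;> nlinarith

lemma circ_int (r : ℂ) (hr : 0 < r.re) (hw : ‖1 - r ^ 2‖ = 1) :
    (∮ ζ in C(0, 1), ζ⁻¹ * (-(ζ + (1 - r ^ 2) / ζ) ^ 2 / (4 - 2 * (ζ + (1 - r ^ 2) / ζ))))
      = 2 * Real.pi * I * (1 - r⁻¹) := by
  obtain ⟨ha, hb⟩ := roots_norm r hr hw
  have hr0 : r ≠ 0 := by rintro rfl; simp at hr
  have hcongr : Set.EqOn
      (fun ζ : ℂ => ζ⁻¹ * (-(ζ + (1 - r ^ 2) / ζ) ^ 2 / (4 - 2 * (ζ + (1 - r ^ 2) / ζ))))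
      (fun ζ : ℂ => (((1 / 2 : ℂ) + (1 - r ^ 2) / 2 * (ζ - 0) ^ (-2 : ℤ)) + (ζ - 0)⁻¹)
        - r⁻¹ * ((ζ - (1 - r))⁻¹ - (ζ - (1 + r))⁻¹)) (Metric.sphere 0 1) := by
    intro ζ hζ
    have hz : ‖ζ‖ = 1 := by simpa using hζ
    have h0 : ζ ≠ 0 := by rintro rfl; simp at hz
    have h1 : ζ - (1 - r) ≠ 0 := by
      intro h; rw [sub_eq_zero.1 h] at hz; linarith
    have h2 : ζ - (1 + r) ≠ 0 := by
      intro h; rw [sub_eq_zero.1 h] at hz; linarith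
    have h3 : 4 - 2 * (ζ + (1 - r ^ 2) / ζ) = -2 * ((ζ - (1 - r)) * (ζ - (1 + r))) / ζ := by
      field_simp; ring
    simp only [h3]
    rw [sub_zero, zpow_neg, show ζ ^ (2 : ℤ) = ζ ^ 2 from zpow_ofNat ζ 2]
    generalize hA : ζ - (1 - r) = A at *
    generalize hB : ζ - (1 + r) = B at *
    have hAB : A = B + 2 * r := by rw [← hA, ← hB]; ring
    have hzB : ζ = B + 1 + r := by rw [← hB]; ring
    field_simp
    rw [hAB, hzB]
    ring
  rw [circleIntegral.integral_congr zero_le_one hcongr]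
  have ca : CircleIntegrable (fun ζ : ℂ => (ζ - (1 - r))⁻¹) 0 1 := by
    rw [circleIntegrable_sub_inv_iff]; right; simp; exact ha.ne
  have cb : CircleIntegrable (fun ζ : ℂ => (ζ - (1 + r))⁻¹) 0 1 := by
    rw [circleIntegrable_sub_inv_iff]; right; simp; exact hb.ne'
  have c0 : CircleIntegrable (fun ζ : ℂ => (ζ - 0)⁻¹) 0 1 := by
    rw [circleIntegrable_sub_inv_iff]; right; simp
  have c1 : CircleIntegrable (fun _ : ℂ => (1 / 2 : ℂ)) 0 1 := circleIntegrable_const _ _ _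
  have c2base : CircleIntegrable (fun ζ : ℂ => (ζ - 0) ^ (-2 : ℤ)) 0 1 := by
    rw [circleIntegrable_sub_zpow_iff]; right; right; simp
  have c2 : CircleIntegrable (fun ζ : ℂ => (1 - r ^ 2) / 2 * (ζ - 0) ^ (-2 : ℤ)) 0 1 := by
    exact c2base.const_smul (a := (1 - r ^ 2) / 2)
  have c3 : CircleIntegrable
      (fun ζ : ℂ => r⁻¹ * ((ζ - (1 - r))⁻¹ - (ζ - (1 + r))⁻¹)) 0 1 :=
    (ca.sub cb).const_smul (a := r⁻¹)
  have ib : (∮ ζ in C(0, 1), (ζ - (1 + r))⁻¹) = 0 := by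
    apply Complex.circleIntegral_eq_zero_of_differentiable_on_off_countable zero_le_one
      Set.countable_empty
    · apply ContinuousOn.inv₀ (by fun_prop)
      intro x hx h
      have : ‖x‖ ≤ 1 := by simpa using hx
      rw [sub_eq_zero.1 h] at this; linarith
    · intro x hx
      have : ‖x‖ < 1 := by simpa using hx
      apply DifferentiableAt.inv (by fun_prop)
      intro h
      rw [sub_eq_zero.1 h] at this; linarith
  have i1 : (∮ ζ in C(0, 1), (1 / 2 : ℂ)) = 0 := by
    apply Complex.circleIntegral_eq_zero_of_differentiable_on_off_countable zero_le_one
      Set.countable_empty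
    · fun_prop
    · intro x hx; fun_prop
  have c12 : CircleIntegrable
      (fun ζ : ℂ => (1 / 2 : ℂ) + (1 - r ^ 2) / 2 * (ζ - 0) ^ (-2 : ℤ)) 0 1 := c1.add c2
  have c120 : CircleIntegrable
      (fun ζ : ℂ => (1 / 2 : ℂ) + (1 - r ^ 2) / 2 * (ζ - 0) ^ (-2 : ℤ) + (ζ - 0)⁻¹) 0 1 :=
    c12.add c0
  rw [circleIntegral.integral_sub c120 c3,
    circleIntegral.integral_add c12 c0, circleIntegral.integral_add c1 c2,
    circleIntegral.integral_const_mul, circleIntegral.integral_const_mul,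
    circleIntegral.integral_sub ca cb, i1, ib,
    circleIntegral.integral_sub_zpow_of_ne (by norm_num),
    circleIntegral.integral_sub_inv_of_mem_ball (by simp),
    circleIntegral.integral_sub_inv_of_mem_ball (by simpa using ha)]
  ring

lemma avg_int (f : ℂ → ℂ) :
    (∫ z in (-(1 / 2) : ℝ)..(1 / 2), f (exp (2 * Real.pi * I * z)))
      = (2 * Real.pi * I)⁻¹ * ∮ ζ in C(0, 1), ζ⁻¹ * f ζ := by
  have hp : Function.Periodic (fun z : ℝ => f (exp (2 * Real.pi * I * z))) 1 := by
    intro z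
    simp only
    congr 1
    push_cast
    rw [mul_add, mul_one, exp_add, exp_two_pi_mul_I, mul_one]
  have h1 := hp.intervalIntegral_add_eq (-(1/2)) 0
  rw [show (-(1/2) : ℝ) + 1 = 1/2 by norm_num, zero_add] at h1
  rw [h1, circleIntegral]
  have h2 : ∀ θ : ℝ, deriv (circleMap 0 1) θ • ((circleMap 0 1 θ)⁻¹ * f (circleMap 0 1 θ))
      = I * f (exp (θ * I)) := by
    intro θ
    have : exp (θ * I) ≠ 0 := exp_ne_zero _
    simp [circleMap]
    field_simp
  simp only [h2]
  rw [intervalIntegral.integral_const_mul]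
  have h3 := intervalIntegral.integral_comp_mul_left (a := 0) (b := 1)
    (fun θ : ℝ => f (exp (θ * I))) (c := 2 * Real.pi) (by positivity)
  simp only [mul_zero, mul_one] at h3
  have hpi : (Real.pi : ℂ) ≠ 0 := by exact_mod_cast Real.pi_ne_zero
  have h4 : (∫ z in (0:ℝ)..1, f (exp (2 * Real.pi * I * z)))
      = ∫ x in (0:ℝ)..1, f (exp (((2 * Real.pi * x : ℝ) : ℂ) * I)) := by
    congr 1; ext x; congr 2; push_cast; ring
  rw [h4, h3, Complex.real_smul]
  push_cast
  generalize (∫ x in (0:ℝ)..2 * Real.pi, f (exp (x * I))) = J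
  have := I_ne_zero
  field_simp

lemma integrand_eq (y z : ℝ) (w ζ : ℂ) (hw : w = exp (2 * Real.pi * I * y))
    (hz : ζ = exp (2 * Real.pi * I * z)) :
    ((Omg (y - z) z : ℂ) ^ 2) / ((Lam (y - z) z : ℂ) - I * (Omg (y - z) z : ℂ))
      = (w - 1) ^ 2 / w ^ 2 * (-(ζ + w / ζ) ^ 2 / (4 - 2 * (ζ + w / ζ))) := by
  have hw0 : w ≠ 0 := hw ▸ exp_ne_zero _
  have hz0 : ζ ≠ 0 := hz ▸ exp_ne_zero _
  have s1 : ∀ t : ℝ, ((Real.sin (2 * Real.pi * t) : ℝ) : ℂ)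
      = ((exp (2 * Real.pi * I * t))⁻¹ - exp (2 * Real.pi * I * t)) * I / 2 := by
    intro t
    rw [ofReal_sin, Complex.sin, ← exp_neg]
    push_cast
    ring_nf
  have s2 : ∀ t : ℝ, ((Real.sin (Real.pi * t) : ℝ) : ℂ) ^ 2
      = 1 / 2 - ((exp (2 * Real.pi * I * t))⁻¹ + exp (2 * Real.pi * I * t)) / 4 := by
    intro t
    have : Real.sin (Real.pi * t) ^ 2 = 1 / 2 - Real.cos (2 * Real.pi * t) / 2 := by
      rw [Real.sin_sq_eq_half_sub]; ring_nf
    rw [← ofReal_pow, this]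
    push_cast
    rw [Complex.cos, ← exp_neg]
    ring_nf
  have e1 : exp (2 * Real.pi * I * ((y - z : ℝ) : ℂ)) = w / ζ := by
    rw [hw, hz, ← exp_sub]; push_cast; ring_nf
  have hO : (Omg (y - z) z : ℂ) = (ζ + w / ζ) * (1 - w) / w * I := by
    unfold Omg
    rw [ofReal_mul, ofReal_add, s1, s1, e1, ← hz]
    push_cast
    field_simp
    ring
  have hL : (Lam (y - z) z : ℂ) - I * (Omg (y - z) z : ℂ) = 4 - 2 * (ζ + w / ζ) := by
    unfold Lam Omg
    rw [ofReal_mul, ofReal_add, ofReal_mul, ofReal_add, ofReal_pow, ofReal_pow, s1, s1, s2, s2,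
      e1, ← hz]
    push_cast
    linear_combination (-((w/ζ)⁻¹ - w/ζ + (ζ⁻¹ - ζ))) * I_sq
  rw [hL, hO]
  rw [mul_pow, I_sq]
  ring

lemma root_eq (y : ℝ) (hy : y ∈ Set.Ioc (-(1 / 2) : ℝ) (1 / 2)) (hy0 : y ≠ 0) (r : ℂ)
    (hr : r = (Real.sqrt (2 * |Real.sin (Real.pi * y)|) : ℂ) *
      exp ((Real.pi * I / 2) * ((y : ℂ) - (Real.sign y : ℂ) / 2))) :
    0 < r.re ∧ 1 - r ^ 2 = exp (2 * Real.pi * I * y) := by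
  obtain ⟨hy1, hy2⟩ := hy
  have hpi := Real.pi_pos
  have key : 0 < |Real.sin (Real.pi * y)| ∧ |y - Real.sign y / 2| ≤ 1 / 2 ∧
      2 * ((|Real.sin (Real.pi * y)| : ℝ) : ℂ) * exp (Real.pi * I * ((y : ℂ) - (Real.sign y : ℂ) / 2))
        = 2 * ((Real.sin (Real.pi * y) : ℝ) : ℂ) * (-I) * exp (Real.pi * I * y) := by
    have hm : exp (-(Real.pi / 2 * I)) = -I := by rw [exp_neg, exp_pi_div_two_mul_I, inv_I]
    rcases lt_or_gt_of_ne hy0 with h | h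
    · have hs : Real.sin (Real.pi * y) < 0 :=
        Real.sin_neg_of_neg_of_neg_pi_lt (by nlinarith) (by nlinarith)
      rw [Real.sign_of_neg h, abs_of_neg hs]
      refine ⟨by linarith, by rw [abs_le]; constructor <;> linarith, ?_⟩
      have : exp (Real.pi * I * ((y : ℂ) - ((-1 : ℝ) : ℂ) / 2)) = exp (Real.pi * I * y) * I := by
        have hI : exp (Real.pi * I * y) * I = exp (Real.pi * I * y) * exp (Real.pi / 2 * I) := by
          rw [exp_pi_div_two_mul_I]
        rw [hI, ← exp_add]; push_cast; ring_nf
      rw [this]; push_cast; ring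
    · have hs : 0 < Real.sin (Real.pi * y) :=
        Real.sin_pos_of_pos_of_lt_pi (by positivity) (by nlinarith)
      rw [Real.sign_of_pos h, abs_of_pos hs]
      refine ⟨by linarith, by rw [abs_le]; constructor <;> linarith, ?_⟩
      have : exp (Real.pi * I * ((y : ℂ) - ((1 : ℝ) : ℂ) / 2)) = exp (Real.pi * I * y) * -I := by
        rw [← hm, ← exp_add]; push_cast; ring_nf
      rw [this]; ring
  obtain ⟨k1, k2, k3⟩ := key
  rw [abs_le] at k2
  constructor
  · have : (Real.pi * I / 2) * ((y : ℂ) - (Real.sign y : ℂ) / 2)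
        = ((Real.pi / 2 * (y - Real.sign y / 2) : ℝ) : ℂ) * I := by push_cast; ring
    rw [hr, this, re_ofReal_mul, exp_ofReal_mul_I_re]
    refine mul_pos (Real.sqrt_pos.2 (by positivity)) (Real.cos_pos_of_mem_Ioo ⟨?_, ?_⟩) <;> nlinarith
  · have hsq : (Real.sqrt (2 * |Real.sin (Real.pi * y)|) : ℂ) ^ 2
        = 2 * ((|Real.sin (Real.pi * y)| : ℝ) : ℂ) := by
      rw [← ofReal_pow, Real.sq_sqrt (by positivity)]; push_cast; rfl
    have he : exp ((Real.pi * I / 2) * ((y : ℂ) - (Real.sign y : ℂ) / 2)) ^ 2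
        = exp (Real.pi * I * ((y : ℂ) - (Real.sign y : ℂ) / 2)) := by
      rw [← exp_nat_mul]; push_cast; ring_nf
    rw [hr, mul_pow, hsq, he, k3, ofReal_sin, Complex.sin]
    have e2 : exp (2 * Real.pi * I * y) = exp (Real.pi * I * y) ^ 2 := by
      rw [← exp_nat_mul]; push_cast; ring_nf
    have e3 : exp (((Real.pi * y : ℝ) : ℂ) * I) = exp (Real.pi * I * y) := by
      push_cast; ring_nf
    rw [neg_mul, exp_neg, e2, e3]
    have := exp_ne_zero (Real.pi * I * y)
    generalize exp (Real.pi * I * y) = E at *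
    field_simp
    rw [I_sq]
    ring

/-- For `y ∈ (−1/2, 1/2]`, `y ≠ 0`, with `w = e^{2iπy}`,
`G(y) = (1/4)((w−1)²/w²)[1 − (2|sin(πy)|)^{−1/2} e^{−(iπ/2)(y − sgn(y)/2)}]`. -/
theorem stmt_11 (y : ℝ) (hy : y ∈ Set.Ioc (-(1 / 2) : ℝ) (1 / 2)) (hy0 : y ≠ 0) :
    Gfun y =
      (1 / 4) * ((Complex.exp (2 * Real.pi * I * y) - 1) ^ 2 /
          (Complex.exp (2 * Real.pi * I * y)) ^ 2) *
        (1 - ((Real.sqrt (2 * |Real.sin (Real.pi * y)|) : ℂ))⁻¹ *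
          Complex.exp (-(Real.pi * I / 2) * ((y : ℂ) - (Real.sign y : ℂ) / 2))) := by
  set r : ℂ := (Real.sqrt (2 * |Real.sin (Real.pi * y)|) : ℂ) *
      exp ((Real.pi * I / 2) * ((y : ℂ) - (Real.sign y : ℂ) / 2)) with hr
  obtain ⟨h1, h2⟩ := root_eq y hy hy0 r hr
  have hn : ‖1 - r ^ 2‖ = 1 := by
    rw [h2, show 2 * Real.pi * I * y = ((2 * Real.pi * y : ℝ) : ℂ) * I by push_cast; ring]
    exact norm_exp_ofReal_mul_I _
  have hinv : ((Real.sqrt (2 * |Real.sin (Real.pi * y)|) : ℂ))⁻¹ *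
      exp (-(Real.pi * I / 2) * ((y : ℂ) - (Real.sign y : ℂ) / 2)) = r⁻¹ := by
    rw [hr, mul_inv, ← exp_neg, neg_mul]
  have hc := circ_int r h1 hn
  rw [hinv]
  unfold Gfun
  simp only [fun z => integrand_eq y z _ _ rfl rfl]
  rw [intervalIntegral.integral_const_mul, ← h2,
    avg_int (fun ζ => -(ζ + (1 - r ^ 2) / ζ) ^ 2 / (4 - 2 * (ζ + (1 - r ^ 2) / ζ))), hc,
    inv_mul_cancel_left₀ two_pi_I_ne_zero]
  ring
end

section
/- For every y ∈ (−1/2, 1/2] with y ≠ 0, the integral I(y) = ∫_{−1/2}^{1/2} (1 − e^{−2iπx}) · i Ω(y−x, x) / (Λ(y−x, x) − i Ω(y−x, x)) dx equals −((w−1)/(2w)) · (1/z₋ + 1 − 2/w), where w = e^{2iπy} and z₋ = 1 − √(2|sin(πy)|) · e^{(iπ/2)(y − (1/2) sgn(y))}. -/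
open Complex

/-- `I(y) = ∫_{−1/2}^{1/2} (1 − e^{−2iπx}) iΩ(y−x,x) / (Λ(y−x,x) − iΩ(y−x,x)) dx`. -/
noncomputable def Ifun (y : ℝ) : ℂ :=
  ∫ x in (-(1 / 2) : ℝ)..(1 / 2),
    (1 - Complex.exp (-(2 * Real.pi * I * x))) * (I * (Omg (y - x) x : ℂ)) /
      ((Lam (y - x) x : ℂ) - I * (Omg (y - x) x : ℂ))

/-- `z₋ = 1 − √(2|sin(πy)|) e^{(iπ/2)(y − sgn(y)/2)}`, the root of `z² − 2z + w` of
modulus `< 1`. -/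
noncomputable def zminus (y : ℝ) : ℂ :=
  1 - (Real.sqrt (2 * |Real.sin (Real.pi * y)|) : ℂ) *
    Complex.exp ((Real.pi * I / 2) * ((y : ℂ) - (Real.sign y : ℂ) / 2))

theorem mean_exp (g : ℂ → ℂ) (hg : DiffContOnCl ℂ g (Metric.ball 0 1)) :
    ∫ x in (-(1 / 2) : ℝ)..(1 / 2), g (Complex.exp (2 * Real.pi * I * x)) = g 0 := by
  have h := DiffContOnCl.circleAverage (R := 1) (c := 0) (f := g) (by simpa using hg)
  rw [Real.circleAverage_eq_integral_add (-Real.pi),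
    intervalIntegral.integral_comp_add_right (fun t => g (circleMap 0 1 t))] at h
  have h2 := intervalIntegral.integral_comp_mul_left (a := -(1/2)) (b := 1/2)
    (fun t => g (circleMap 0 1 t)) (c := 2 * Real.pi) (by positivity)
  rw [← h]
  have e1 : 2 * Real.pi * -(1/2) = 0 + -Real.pi := by ring
  have e2 : 2 * Real.pi * (1/2) = 2 * Real.pi + -Real.pi := by ring
  rw [e1, e2] at h2
  rw [← h2]
  congr 1
  funext x
  simp only [circleMap]
  congr 1
  push_cast
  rw [zero_add, one_mul]
  congr 1
  ring

theorem mean_exp_neg (g : ℂ → ℂ) (hg : DiffContOnCl ℂ g (Metric.ball 0 1)) :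
    ∫ x in (-(1 / 2) : ℝ)..(1 / 2), g (Complex.exp (-(2 * Real.pi * I * x))) = g 0 := by
  have h := intervalIntegral.integral_comp_neg (a := -(1/2)) (b := 1/2)
    (fun x : ℝ => g (Complex.exp (2 * Real.pi * I * x)))
  rw [neg_neg, mean_exp g hg] at h
  rw [← h]
  congr 1
  funext x
  push_cast
  ring_nf

theorem cont_of_diff (g : ℂ → ℂ) (hg : DiffContOnCl ℂ g (Metric.ball 0 1)) (s : ℝ → ℂ)
    (hs : Continuous s) (h1 : ∀ x, ‖s x‖ = 1) : Continuous fun x => g (s x) := by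
  have h := hg.continuousOn
  rw [closure_ball _ one_ne_zero] at h
  exact h.comp_continuous hs (fun x => by simp [h1 x])

theorem zminus_sq (y : ℝ) (hy : y ∈ Set.Ioc (-(1 / 2) : ℝ) (1 / 2)) (hy0 : y ≠ 0) :
    (1 - zminus y) ^ 2 = 1 - Complex.exp (2 * Real.pi * I * y) := by
  have hpi := Real.pi_pos
  have key : ∀ s : ℝ, (s = 1 ∨ s = -1) → |Real.sin (Real.pi * y)| = s * Real.sin (Real.pi * y) →
      2 * ((|Real.sin (Real.pi * y)| : ℝ) : ℂ) * Complex.exp (Real.pi * I * (y - s / 2)) =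
        1 - Complex.exp (2 * Real.pi * I * y) := by
    intro s hs h
    rw [h]
    have e0 : Complex.exp (2 * Real.pi * I * y) =
        Complex.exp (Real.pi * y * I) * Complex.exp (Real.pi * y * I) := by
      rw [← Complex.exp_add]; ring_nf
    have e3 : Complex.exp (-(Real.pi * y) * I) * Complex.exp (Real.pi * y * I) = 1 := by
      rw [← Complex.exp_add]; simp
    have e1 : Complex.exp (Real.pi * I * (y - s / 2)) = Complex.exp (Real.pi * y * I) * (-s * I) := by
      have : (Real.pi * I * (y - s / 2) : ℂ) = Real.pi * y * I + -(s * (Real.pi / 2 * I)) := by ring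
      rw [this, Complex.exp_add]
      congr 1
      rcases hs with rfl | rfl
      · simp [Complex.exp_neg, Complex.exp_pi_div_two_mul_I]
      · simp [Complex.exp_pi_div_two_mul_I]
    have hs2 : (s : ℂ) ^ 2 = 1 := by rcases hs with rfl | rfl <;> simp
    rw [e1, e0]
    push_cast
    rw [Complex.sin]
    linear_combination (Complex.exp (-(Real.pi * y) * I) * Complex.exp (Real.pi * y * I) - Complex.exp (Real.pi * y * I) ^ 2) * (-I ^ 2 * hs2 - Complex.I_sq) + e3
  have hr : ((Real.sqrt (2 * |Real.sin (Real.pi * y)|) : ℝ) : ℂ) ^ 2 =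
      2 * ((|Real.sin (Real.pi * y)| : ℝ) : ℂ) := by
    rw [← Complex.ofReal_pow, Real.sq_sqrt (by positivity)]; push_cast; rfl
  have he : ∀ s : ℝ, Complex.exp ((Real.pi * I / 2) * ((y : ℂ) - (s : ℂ) / 2)) ^ 2 =
      Complex.exp (Real.pi * I * (y - s / 2)) := by
    intro s
    rw [← Complex.exp_nat_mul]; congr 1; push_cast; ring
  rw [zminus, sub_sub_cancel, mul_pow, hr, he]
  apply key
  · rcases lt_or_gt_of_ne hy0 with h | h
    · right; exact Real.sign_of_neg h
    · left; exact Real.sign_of_pos h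
  · rcases lt_or_gt_of_ne hy0 with h | h
    · rw [Real.sign_of_neg h, abs_of_nonpos]
      · ring
      · apply Real.sin_nonpos_of_nonpos_of_neg_pi_le <;> nlinarith [hy.1, hy.2]
    · rw [Real.sign_of_pos h, abs_of_nonneg]
      · ring
      · apply Real.sin_nonneg_of_nonneg_of_le_pi <;> nlinarith [hy.1, hy.2]

theorem zminus_norm (y : ℝ) (hy : y ∈ Set.Ioc (-(1 / 2) : ℝ) (1 / 2)) (hy0 : y ≠ 0) :
    ‖zminus y‖ < 1 := by
  have hpi := Real.pi_pos
  obtain ⟨hy1, hy2⟩ := hy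
  set r := Real.sqrt (2 * |Real.sin (Real.pi * y)|) with hr
  set θ := Real.pi / 2 * (y - Real.sign y / 2) with hθ
  have hz : zminus y = ((1 - r * Real.cos θ : ℝ) : ℂ) + ((-(r * Real.sin θ) : ℝ) : ℂ) * I := by
    have : ((Real.pi * I / 2) * ((y : ℂ) - (Real.sign y : ℂ) / 2)) = (θ : ℂ) * I := by
      rw [hθ]; push_cast; ring
    rw [zminus, this, Complex.exp_mul_I]
    push_cast
    ring
  have hr2 : r ^ 2 = 2 * |Real.sin (Real.pi * y)| := Real.sq_sqrt (by positivity)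
  have hfact : Real.sin (Real.pi * y) ≠ 0 ∧ 0 < Real.cos θ ∧
      Real.cos (2 * θ) = |Real.sin (Real.pi * y)| := by
    rcases lt_or_gt_of_ne hy0 with h | h
    · have hs : Real.sin (Real.pi * y) < 0 :=
        Real.sin_neg_of_neg_of_neg_pi_lt (by nlinarith) (by nlinarith)
      rw [Real.sign_of_neg h] at hθ
      refine ⟨hs.ne, Real.cos_pos_of_mem_Ioo ⟨?_, ?_⟩, ?_⟩
      · rw [hθ]; nlinarith
      · rw [hθ]; nlinarith
      · rw [abs_of_neg hs, show 2 * θ = Real.pi * y + Real.pi / 2 by rw [hθ]; ring,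
          Real.cos_add_pi_div_two]
    · have hs : 0 < Real.sin (Real.pi * y) :=
        Real.sin_pos_of_pos_of_lt_pi (by nlinarith) (by nlinarith)
      rw [Real.sign_of_pos h] at hθ
      refine ⟨hs.ne', Real.cos_pos_of_mem_Ioo ⟨?_, ?_⟩, ?_⟩
      · rw [hθ]; nlinarith
      · rw [hθ]; nlinarith
      · rw [abs_of_pos hs, show 2 * θ = Real.pi * y - Real.pi / 2 by rw [hθ]; ring,
          Real.cos_sub_pi_div_two]
  obtain ⟨h0, hc, h2⟩ := hfact
  have hrpos : 0 < r := Real.sqrt_pos.2 (by positivity)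
  rw [Real.cos_two_mul] at h2
  have hlt : r < 2 * Real.cos θ := by
    apply lt_of_pow_lt_pow_left₀ 2 (by positivity)
    nlinarith
  have hn : ‖zminus y‖ ^ 2 < 1 := by
    rw [← Complex.normSq_eq_norm_sq, hz, Complex.normSq_add_mul_I]
    nlinarith [Real.sin_sq_add_cos_sq θ, mul_pos hrpos (sub_pos.2 hlt)]
  nlinarith [norm_nonneg (zminus y)]

/-- For `y ∈ (−1/2, 1/2]`, `y ≠ 0`, with `w = e^{2iπy}`,
`I(y) = −((w−1)/(2w)) (1/z₋ + 1 − 2/w)`. -/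
theorem stmt_13 (y : ℝ) (hy : y ∈ Set.Ioc (-(1 / 2) : ℝ) (1 / 2)) (hy0 : y ≠ 0) :
    Ifun y =
      -((Complex.exp (2 * Real.pi * I * y) - 1) / (2 * Complex.exp (2 * Real.pi * I * y))) *
        (1 / zminus y + 1 - 2 / Complex.exp (2 * Real.pi * I * y)) := by
  have hsq := zminus_sq y hy hy0
  have hm := zminus_norm y hy hy0
  have hw1 : ‖Complex.exp (2 * Real.pi * I * y)‖ = 1 := by
    rw [show (2 * Real.pi * I * y : ℂ) = ((2 * Real.pi * y : ℝ) : ℂ) * I by push_cast; ring]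
    exact Complex.norm_exp_ofReal_mul_I _
  have hw0 : Complex.exp (2 * Real.pi * I * y) ≠ 0 := Complex.exp_ne_zero _
  generalize hw : Complex.exp (2 * Real.pi * I * y) = w at *
  generalize hzm : zminus y = m at *
  have hprod : m * (2 - m) = w := by linear_combination -hsq
  have hm0 : m ≠ 0 := by rintro rfl; simp at hprod; exact hw0 hprod.symm
  have hmpos : 0 < ‖m‖ := norm_pos_iff.2 hm0
  have hp : 1 < ‖2 - m‖ := by
    have : ‖m‖ * ‖2 - m‖ = 1 := by rw [← norm_mul, hprod, hw1]
    by_contra hcon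
    push Not at hcon
    nlinarith
  have hp0 : (2 - m) ≠ 0 := by intro h; rw [h] at hp; simp at hp; linarith
  set C : ℂ := -((w - 1) / (2 * w)) with hC
  let F : ℂ → ℂ := fun z => C * (1 + 1 / (z - (2 - m)))
  let G : ℂ → ℂ := fun u => C * (-u + u / (1 - m * u))
  have hF : DiffContOnCl ℂ F (Metric.ball 0 1) := by
    apply DifferentiableOn.diffContOnCl
    rw [closure_ball _ one_ne_zero]
    intro z hz
    rw [mem_closedBall_zero_iff] at hz
    have : z - (2 - m) ≠ 0 := by
      intro h; rw [sub_eq_zero.1 h] at hz; linarith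
    apply DifferentiableAt.differentiableWithinAt
    fun_prop (disch := assumption)
  have hG : DiffContOnCl ℂ G (Metric.ball 0 1) := by
    apply DifferentiableOn.diffContOnCl
    rw [closure_ball _ one_ne_zero]
    intro z hz
    rw [mem_closedBall_zero_iff] at hz
    have : 1 - m * z ≠ 0 := by
      intro h
      have h' := congrArg norm (sub_eq_zero.1 h)
      rw [norm_mul, norm_one] at h'
      nlinarith [norm_nonneg z]
    apply DifferentiableAt.differentiableWithinAt
    fun_prop (disch := assumption)
  have hn1 : ∀ x : ℝ, ‖Complex.exp (2 * Real.pi * I * x)‖ = 1 := by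
    intro x
    rw [show (2 * Real.pi * I * x : ℂ) = ((2 * Real.pi * x : ℝ) : ℂ) * I by push_cast; ring]
    exact Complex.norm_exp_ofReal_mul_I _
  have hn2 : ∀ x : ℝ, ‖Complex.exp (-(2 * Real.pi * I * x))‖ = 1 := by
    intro x
    rw [Complex.exp_neg, norm_inv, hn1, inv_one]
  have hint : ∀ x : ℝ, (1 - Complex.exp (-(2 * Real.pi * I * x))) * (I * (Omg (y - x) x : ℂ)) /
      ((Lam (y - x) x : ℂ) - I * (Omg (y - x) x : ℂ)) =
      F (Complex.exp (2 * Real.pi * I * x)) + G (Complex.exp (-(2 * Real.pi * I * x))) := by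
    intro x
    have hz1 := hn1 x
    have hz0 : Complex.exp (2 * Real.pi * I * x) ≠ 0 := Complex.exp_ne_zero _
    have hO : I * (Omg (y - x) x : ℂ) = (w / Complex.exp (2 * Real.pi * I * x) -
        Complex.exp (2 * Real.pi * I * x) / w) + (Complex.exp (2 * Real.pi * I * x) -
          1 / Complex.exp (2 * Real.pi * I * x)) := by
      rw [← hw, ← Complex.exp_sub, ← Complex.exp_sub, one_div, ← Complex.exp_neg, Omg]
      push_cast
      rw [Complex.sin, Complex.sin]
      ring_nf
      simp only [Complex.I_sq]
      ring_nf
    have hL : (Lam (y - x) x : ℂ) = 4 - (w / Complex.exp (2 * Real.pi * I * x) +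
        Complex.exp (2 * Real.pi * I * x) / w) - (Complex.exp (2 * Real.pi * I * x) +
          1 / Complex.exp (2 * Real.pi * I * x)) := by
      have hh : Lam (y - x) x = 4 - 2 * Real.cos (2 * Real.pi * (y - x)) -
          2 * Real.cos (2 * Real.pi * x) := by
        rw [Lam, Real.sin_sq_eq_half_sub, Real.sin_sq_eq_half_sub]; ring_nf
      rw [← hw, ← Complex.exp_sub, ← Complex.exp_sub, one_div, ← Complex.exp_neg, hh]
      push_cast
      rw [Complex.cos, Complex.cos]
      ring_nf
    rw [hO, hL, Complex.exp_neg]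
    generalize Complex.exp (2 * Real.pi * I * x) = z at *
    have d1 : z - (2 - m) ≠ 0 := by
      intro h; rw [sub_eq_zero.1 h] at hz1; linarith
    have d2 : z - m ≠ 0 := by
      intro h; rw [sub_eq_zero.1 h] at hz1; linarith
    have d3 : 1 - m * z⁻¹ ≠ 0 := by
      intro h; apply d2; field_simp at h; simpa using h
    have hden : (4 - (w / z + z / w) - (z + 1 / z) - ((w / z - z / w) + (z - 1 / z))) =
        -2 * ((z - m) * (z - (2 - m))) / z := by
      field_simp
      linear_combination 2 * w * hprod
    have hnum : (w / z - z / w) + (z - 1 / z) =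
        (w - 1) / w * (2 * z + (z - m) * (z - (2 - m))) / z := by
      field_simp
      linear_combination (1 - w) * hprod
    have hu : z⁻¹ / (1 - m * z⁻¹) = 1 / (z - m) := by
      field_simp
    rw [hden, hnum]
    simp only [F, G]
    rw [hu, hC]
    field_simp
    ring
  rw [Ifun]
  simp_rw [hint]
  rw [intervalIntegral.integral_add, mean_exp F hF, mean_exp_neg G hG]
  · simp only [F, G]
    have h1 : 1 / m = (2 - m) / w := by rw [← hprod]; field_simp
    have h2 : 1 / (2 - m) = m / w := by rw [← hprod]; field_simp
    have h3 : 1 / (0 - (2 - m)) = - (m / w) := by rw [← h2, zero_sub, div_neg]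
    rw [h1, h3]
    ring
  · exact (cont_of_diff F hF _ (by fun_prop) hn1).intervalIntegrable _ _
  · exact (cont_of_diff G hG _ (by fun_prop) hn2).intervalIntegrable _ _
end

section
/- There exists a constant C > 0 such that for every y ∈ [−1/2, 1/2] with y ≠ 0, W(y) ≤ C |y|^{−3/2}, where W(y) = ∫_{−1/2}^{1/2} dx / (Λ(y−x, x)² + Ω(y−x, x)²). -/
/-- `W(y) = ∫_{−1/2}^{1/2} dx / (Λ(y−x,x)² + Ω(y−x,x)²)`. -/
noncomputable def Wfun (y : ℝ) : ℝ :=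
  ∫ x in (-(1 / 2) : ℝ)..(1 / 2), (Lam (y - x) x ^ 2 + Omg (y - x) x ^ 2)⁻¹

lemma denom_eq (x y : ℝ) : Lam (y - x) x ^ 2 + Omg (y - x) x ^ 2
    = 16 * ((Real.cos (2 * Real.pi * (x - y / 2)) - Real.cos (Real.pi * y)) ^ 2
      + Real.sin (Real.pi * y) ^ 2) := by
  unfold Lam Omg
  set p := Real.pi * (y - x) with hp
  set q := Real.pi * x with hq
  have e1 : 2 * Real.pi * (y - x) = 2 * p := by rw [hp]; ring
  have e2 : 2 * Real.pi * x = 2 * q := by rw [hq]; ring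
  have e3 : 2 * Real.pi * (x - y / 2) = q - p := by rw [hp, hq]; ring
  have e4 : Real.pi * y = p + q := by rw [hp, hq]; ring
  rw [e1, e2, e3, e4, Real.sin_two_mul, Real.sin_two_mul, Real.cos_sub, Real.cos_add, Real.sin_add]
  have h1 := Real.sin_sq_add_cos_sq p
  have h2 := Real.sin_sq_add_cos_sq q
  generalize Real.sin p = a at *
  generalize Real.cos p = b at *
  generalize Real.sin q = c at *
  generalize Real.cos q = d at *
  have hb : b ^ 2 = 1 - a ^ 2 := by linarith
  have hd : d ^ 2 = 1 - c ^ 2 := by linarith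
  ring_nf
  simp only [hb, hd]
  ring

lemma two_abs_le (z : ℝ) (hz : |z| ≤ 1 / 2) : 4 * z ^ 2 ≤ Real.sin (Real.pi * z) ^ 2 := by
  have hpi := Real.pi_pos
  have h : 2 * |z| ≤ Real.sin (Real.pi * |z|) := by
    have := Real.mul_le_sin (x := Real.pi * |z|) (by positivity) (by nlinarith)
    have e : 2 / Real.pi * (Real.pi * |z|) = 2 * |z| := by field_simp
    linarith
  have e : Real.sin (Real.pi * z) ^ 2 = Real.sin (Real.pi * |z|) ^ 2 := by
    rcases abs_cases z with ⟨h, _⟩ | ⟨h, _⟩ <;> rw [h]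
    rw [mul_neg, Real.sin_neg]; ring
  rw [e]
  have := abs_nonneg z
  have := sq_abs z
  nlinarith

lemma denom_ge (z y : ℝ) (hz : |z| ≤ 1 / 2) (hy : |y| ≤ 1 / 2) :
    z ^ 4 + y ^ 2 ≤ 16 * ((Real.cos (2 * Real.pi * z) - Real.cos (Real.pi * y)) ^ 2
      + Real.sin (Real.pi * y) ^ 2) := by
  have h1 := two_abs_le z hz
  have h2 := two_abs_le y hy
  have hw : Real.cos (2 * Real.pi * z) = 1 - 2 * Real.sin (Real.pi * z) ^ 2 := by
    rw [mul_assoc, Real.cos_two_mul, Real.cos_sq']; ring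
  have hc0 : 0 ≤ Real.cos (Real.pi * y) := by
    have := abs_le.1 hy
    have hpi := Real.pi_pos
    apply Real.cos_nonneg_of_mem_Icc; constructor <;> nlinarith
  have hc1 := Real.cos_le_one (Real.pi * y)
  have hs := Real.sin_sq_add_cos_sq (Real.pi * y)
  rw [hw]
  generalize Real.sin (Real.pi * z) ^ 2 = w at *
  generalize Real.cos (Real.pi * y) = c at *
  generalize Real.sin (Real.pi * y) ^ 2 = s at *
  have hk : (1 - c) ^ 2 ≤ s := by nlinarith
  have h3 : (2 * w) ^ 2 ≤ 2 * (1 - 2 * w - c) ^ 2 + 2 * s := by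
    nlinarith [sq_nonneg (2 * w - 2 * (1 - c))]
  have h4 : (4 * z ^ 2) ^ 2 ≤ w ^ 2 := pow_le_pow_left₀ (by positivity) h1 2
  nlinarith [sq_nonneg (1 - 2 * w - c), sq_nonneg z, sq_nonneg y, sq_nonneg (z ^ 2)]

theorem stmt_16 :
    ∃ C : ℝ, 0 < C ∧ ∀ y : ℝ, |y| ≤ 1 / 2 → y ≠ 0 →
      Wfun y ≤ C * |y| ^ (-(3 : ℝ) / 2) := by
  have hpi := Real.pi_pos
  refine ⟨2 * Real.pi, by positivity, fun y hy hy0 => ?_⟩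
  have hya : 0 < |y| := abs_pos.2 hy0
  set t := √|y| with ht
  have ht0 : 0 < t := Real.sqrt_pos.2 hya
  have ht2 : t ^ 2 = |y| := Real.sq_sqrt hya.le
  have hpow : |y| ^ (-(3 : ℝ) / 2) = (t ^ 3)⁻¹ := by
    rw [← ht2, ← Real.rpow_natCast t 2, ← Real.rpow_mul ht0.le,
      ← Real.rpow_natCast t 3, ← Real.rpow_neg ht0.le]
    norm_num
  let G : ℝ → ℝ := fun z => (16 * ((Real.cos (2 * Real.pi * z) - Real.cos (Real.pi * y)) ^ 2
      + Real.sin (Real.pi * y) ^ 2))⁻¹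
  have hper : Function.Periodic G 1 := by
    intro z
    simp only [G]
    rw [show 2 * Real.pi * (z + 1) = 2 * Real.pi * z + 2 * Real.pi by ring, Real.cos_add_two_pi]
  have hW : Wfun y = ∫ z in (-(1 / 2) : ℝ)..(1 / 2), G z := by
    unfold Wfun
    simp only [denom_eq]
    rw [show (fun x : ℝ => (16 * ((Real.cos (2 * Real.pi * (x - y / 2)) - Real.cos (Real.pi * y)) ^ 2
      + Real.sin (Real.pi * y) ^ 2))⁻¹) = fun x => G (x - y / 2) from rfl,
      intervalIntegral.integral_comp_sub_right]
    have := hper.intervalIntegral_add_eq (-(1 / 2) - y / 2) (-(1 / 2))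
    convert this using 2 <;> ring
  have hs : 0 < Real.sin (Real.pi * y) ^ 2 := by
    have := two_abs_le y hy
    have : 0 < y ^ 2 := by positivity
    linarith
  have hGc : Continuous G := by
    apply Continuous.inv₀ (by fun_prop)
    intro z; positivity
  have hHc : Continuous (fun u : ℝ => (1 + u ^ 2)⁻¹) := by
    apply Continuous.inv₀ (by fun_prop)
    intro z; positivity
  rw [hW, hpow]
  calc ∫ z in (-(1 / 2) : ℝ)..(1 / 2), G z
      ≤ ∫ z in (-(1 / 2) : ℝ)..(1 / 2), 2 * (t ^ 4)⁻¹ * (1 + (z / t) ^ 2)⁻¹ := by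
        apply intervalIntegral.integral_mono_on (by norm_num) (hGc.intervalIntegrable _ _)
        · exact (continuous_const.mul
            (hHc.comp (continuous_id.div_const t))).intervalIntegrable _ _
        · intro z hz
          have h := denom_ge z y (abs_le.2 ⟨hz.1, hz.2⟩) hy
          have hy2 : y ^ 2 = t ^ 4 := by rw [← sq_abs, ← ht2]; ring
          have e : 2 * (t ^ 4)⁻¹ * (1 + (z / t) ^ 2)⁻¹ = (t ^ 2 * (t ^ 2 + z ^ 2) / 2)⁻¹ := by
            field_simp
          rw [e]
          apply inv_anti₀ (by positivity)
          refine le_trans ?_ h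
          rw [hy2]
          nlinarith [sq_nonneg (z ^ 2 - t ^ 2), sq_nonneg (z ^ 2), sq_nonneg (t ^ 2)]
    _ = 2 * (t ^ 4)⁻¹ * (t * (Real.arctan (1 / 2 / t) - Real.arctan (-(1 / 2) / t))) := by
        rw [intervalIntegral.integral_const_mul,
          intervalIntegral.integral_comp_div (fun u : ℝ => (1 + u ^ 2)⁻¹) ht0.ne',
          integral_inv_one_add_sq, smul_eq_mul]
    _ ≤ 2 * (t ^ 4)⁻¹ * (t * Real.pi) := by
        have := Real.arctan_lt_pi_div_two (1 / 2 / t)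
        have := Real.neg_pi_div_two_lt_arctan (-(1 / 2) / t)
        gcongr
        linarith
    _ = 2 * Real.pi * (t ^ 3)⁻¹ := by field_simp
end

section
/- Let f: ℤ² → ℝ be symmetric (f(x,y) = f(y,x)) with finite support, and let η: ℤ → ℝ be any function. Define Q(f)(η) = Σ_{x ≠ y} η(x) η(y) f(x,y), S Q(f)(η) = Σ_{x ∈ ℤ} (Q(f)(η^{x,x+1}) − Q(f)(η)), and A Q(f)(η) = Σ_{x ∈ ℤ} (η(x+1) − η(x−1)) ∂_x Q(f)(η), where η^{x,x+1} is the configuration η with the values at x and x+1 exchanged and ∂_x denotes the partial derivative with respect to η(x). Then S Q(f)(η) + A Q(f)(η) = Q((Δ + 𝒜) f)(η) + D(f)(η), where Δf(x,y) = f(x+1,y) + f(x−1,y) + f(x,y+1) + f(x,y−1) − 4 f(x,y), 𝒜f(x,y) = f(x−1,y) + f(x,y−1) − f(x+1,y) − f(x,y+1), and D(f)(η) = 2 Σ_{x ∈ ℤ} η(x)² (f(x−1,x) − f(x,x+1)) + 4 Σ_{x ∈ ℤ} η(x) η(x+1) (f(x,x+1) − f(x,x)). -/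
/-- The quadratic field `Q(f)(η) = ∑_{x ≠ y} η(x) η(y) f(x,y)`. -/
noncomputable def Qfield (f : ℤ → ℤ → ℝ) (η : ℤ → ℝ) : ℝ :=
  ∑' p : ℤ × ℤ, if p.1 ≠ p.2 then η p.1 * η p.2 * f p.1 p.2 else 0

/-- The configuration `η^{x,x+1}`, exchanging the values of `η` at `x` and `x+1`. -/
def swapBond (η : ℤ → ℝ) (x : ℤ) : ℤ → ℝ :=
  fun z => if z = x then η (x + 1) else if z = x + 1 then η x else η z

/-- `S Q(f)(η) = ∑_x (Q(f)(η^{x,x+1}) − Q(f)(η))`. -/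
noncomputable def SQ (f : ℤ → ℤ → ℝ) (η : ℤ → ℝ) : ℝ :=
  ∑' x : ℤ, (Qfield f (swapBond η x) - Qfield f η)

/-- `A Q(f)(η) = ∑_x (η(x+1) − η(x−1)) ∂_x Q(f)(η)`, with
`∂_x Q(f)(η) = 2 ∑_{y ≠ x} η(y) f(x,y)`. -/
noncomputable def AQ (f : ℤ → ℤ → ℝ) (η : ℤ → ℝ) : ℝ :=
  ∑' x : ℤ, (η (x + 1) - η (x - 1)) *
    (2 * ∑' y : ℤ, if y ≠ x then η y * f x y else 0)

/-- The discrete Laplacian on `ℤ²`. -/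
def discLap (f : ℤ → ℤ → ℝ) : ℤ → ℤ → ℝ :=
  fun x y => f (x + 1) y + f (x - 1) y + f x (y + 1) + f x (y - 1) - 4 * f x y

/-- The discrete derivative in the direction `(−2,−2)`. -/
def discA (f : ℤ → ℤ → ℝ) : ℤ → ℤ → ℝ :=
  fun x y => f (x - 1) y + f x (y - 1) - f (x + 1) y - f x (y + 1)

/-- The diagonal term `D(f)(η)`. -/
noncomputable def Dterm (f : ℤ → ℤ → ℝ) (η : ℤ → ℝ) : ℝ :=
  2 * ∑' x : ℤ, η x ^ 2 * (f (x - 1) x - f x (x + 1)) +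
    4 * ∑' x : ℤ, η x * η (x + 1) * (f x (x + 1) - f x x)

theorem hs_congr {α : Type} {g k : α → ℝ} {a : ℝ} (h : HasSum g a) (e : ∀ z, k z = g z) :
    HasSum k a := by
  have : k = g := funext e
  rw [this]
  exact h

/-- Weighted sum over the support. -/
noncomputable def Tsum (F : Finset (ℤ × ℤ)) (f : ℤ → ℤ → ℝ) (φ : ℤ → ℤ → ℝ) : ℝ :=
  ∑ p ∈ F, φ p.1 p.2 * f p.1 p.2

theorem hasSum_T (F : Finset (ℤ × ℤ)) (f : ℤ → ℤ → ℝ)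
    (hF : ∀ p : ℤ × ℤ, p ∉ F → f p.1 p.2 = 0) (φ : ℤ → ℤ → ℝ) :
    HasSum (fun p : ℤ × ℤ => φ p.1 p.2 * f p.1 p.2) (Tsum F f φ) := by
  unfold Tsum
  apply hasSum_sum_of_ne_finset_zero
  intro p hp
  rw [hF p hp, mul_zero]

theorem hasSum_shift (F : Finset (ℤ × ℤ)) (f : ℤ → ℤ → ℝ)
    (hF : ∀ p : ℤ × ℤ, p ∉ F → f p.1 p.2 = 0) (φ : ℤ → ℤ → ℝ) (a b : ℤ) :
    HasSum (fun p : ℤ × ℤ => φ p.1 p.2 * f (p.1 + a) (p.2 + b))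
      (Tsum F f (fun x y => φ (x - a) (y - b))) := by
  have h := hasSum_T F f hF (fun x y => φ (x - a) (y - b))
  rw [← ((Equiv.addRight a).prodCongr (Equiv.addRight b)).hasSum_iff] at h
  convert h using 2 with p
  simp

theorem T_sym (F : Finset (ℤ × ℤ)) (f : ℤ → ℤ → ℝ) (hsym : ∀ x y : ℤ, f x y = f y x)
    (hF : ∀ p : ℤ × ℤ, p ∉ F → f p.1 p.2 = 0) (φ : ℤ → ℤ → ℝ) :
    Tsum F f (fun x y => φ y x) = Tsum F f φ := by
  have h := hasSum_T F f hF φ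
  rw [← (Equiv.prodComm ℤ ℤ).hasSum_iff] at h
  have h2 := hasSum_T F f hF (fun x y => φ y x)
  refine h2.unique ?_
  convert h using 2 with p
  simp [hsym p.1 p.2]

theorem hasSum_diag (F : Finset (ℤ × ℤ)) (f : ℤ → ℤ → ℝ)
    (hF : ∀ p : ℤ × ℤ, p ∉ F → f p.1 p.2 = 0) (ψ : ℤ → ℝ) (a b : ℤ) :
    HasSum (fun x : ℤ => ψ x * f (x + a) (x + b))
      (Tsum F f (fun x y => if x - a = y - b then ψ (x - a) else 0)) := by
  have h := hasSum_T F f hF (fun x y => if x - a = y - b then ψ (x - a) else 0)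
  have hi : Function.Injective (fun x : ℤ => ((x + a, x + b) : ℤ × ℤ)) := by
    intro x y hxy
    simpa using (Prod.ext_iff.1 hxy).1
  rw [← hi.hasSum_iff] at h
  · convert h using 2 with x
    simp
  · intro p hp
    have : p.1 - a ≠ p.2 - b := by
      intro h0
      apply hp
      refine ⟨p.1 - a, ?_⟩
      ext <;> simp
      omega
    simp [this]

theorem Q_eq (F : Finset (ℤ × ℤ)) (f : ℤ → ℤ → ℝ)
    (hF : ∀ p : ℤ × ℤ, p ∉ F → f p.1 p.2 = 0) (η : ℤ → ℝ) :
    Qfield f η = Tsum F f (fun x y => if x ≠ y then η x * η y else 0) := by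
  rw [← (hasSum_T F f hF _).tsum_eq]
  unfold Qfield
  congr 1
  ext p
  split_ifs <;> simp

/-- Coefficient of the exchange part. -/
noncomputable def KS (η : ℤ → ℝ) (x y : ℤ) : ℝ :=
  if x ≠ y then
    (η (x + 1) - η x) * η y + (η (x - 1) - η x) * η y
      + η x * (η (y + 1) - η y) + η x * (η (y - 1) - η y)
      - (if y = x + 1 then (η y - η x) ^ 2 else 0)
      - (if x = y + 1 then (η y - η x) ^ 2 else 0)
  else 0

theorem hasSum_bond (η : ℤ → ℝ) (x y : ℤ) :
    HasSum (fun z : ℤ => (if x ≠ y then swapBond η z x * swapBond η z y else 0)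
      - (if x ≠ y then η x * η y else 0)) (KS η x y) := by
  unfold KS
  by_cases hxy : x = y
  · simp [hxy, hasSum_zero]
  simp only [ne_eq, hxy, not_false_eq_true, if_true]
  have h := (((((hasSum_ite_eq x ((η (x + 1) - η x) * η y)).add
    (hasSum_ite_eq (x - 1) ((η (x - 1) - η x) * η y))).add
    (hasSum_ite_eq y (η x * (η (y + 1) - η y)))).add
    (hasSum_ite_eq (y - 1) (η x * (η (y - 1) - η y)))).sub
    (hasSum_ite_eq x (if y = x + 1 then (η y - η x) ^ 2 else 0))).sub
    (hasSum_ite_eq y (if x = y + 1 then (η y - η x) ^ 2 else 0))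
  refine hs_congr h (fun z => ?_)
  unfold swapBond
  by_cases h1 : z = x
  · subst h1
    by_cases h2 : y = z + 1
    · subst h2
      have e1 : ¬ (z = z - 1) := by omega
      have e2 : ¬ (z = z + 1 + 1) := by omega
      simp [e1, e2]
      ring
    · have e1 : ¬ (z = z - 1) := by omega
      have e2 : ¬ (z = y - 1) := by omega
      have e3 : ¬ (y = z) := by omega
      simp [e1, e2, e3, h2, hxy]
      ring
  · by_cases h2 : z = y
    · subst h2
      by_cases h3 : x = z + 1
      · subst h3
        have e1 : ¬ (z = z - 1) := by omega
        simp [e1]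
        ring
      · have e1 : ¬ (z = z - 1) := by omega
        have e2 : ¬ (z = x - 1) := by omega
        simp [e1, e2, h1, h3, hxy]
        ring
    · by_cases h3 : z = x - 1
      · subst h3
        have e1 : ¬ (x - 1 = y - 1) := by omega
        have e2 : ¬ (y = x) := by omega
        have e3 : ¬ (y = x - 1) := by omega
        have e4 : ¬ (x = x - 1) := by omega
        simp [e1, e2, e3, e4, h2]
        ring
      · by_cases h4 : z = y - 1
        · subst h4
          have e1 : ¬ (x = y - 1) := by omega
          have e2 : ¬ (y - 1 = x) := by omega
          have e3 : ¬ (y - 1 = x - 1) := by omega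
          have e4 : ¬ (y = y - 1) := by omega
          simp [e1, e2, e3, e4, hxy]
          ring
        · have e1 : ¬ (x = z) := by omega
          have e2 : ¬ (x = z + 1) := by omega
          have e3 : ¬ (y = z) := by omega
          have e4 : ¬ (y = z + 1) := by omega
          simp [e1, e2, e3, e4, h1, h2, h3, h4]

theorem SQ_eq (F : Finset (ℤ × ℤ)) (f : ℤ → ℤ → ℝ)
    (hF : ∀ p : ℤ × ℤ, p ∉ F → f p.1 p.2 = 0) (η : ℤ → ℝ) :
    SQ f η = Tsum F f (KS η) := by
  unfold SQ
  have h : HasSum (fun z : ℤ => ∑ p ∈ F, ((if p.1 ≠ p.2 then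
      swapBond η z p.1 * swapBond η z p.2 else 0)
      - (if p.1 ≠ p.2 then η p.1 * η p.2 else 0)) * f p.1 p.2) (Tsum F f (KS η)) := by
    unfold Tsum
    exact hasSum_sum (fun p _ => (hasSum_bond η p.1 p.2).mul_right _)
  rw [← h.tsum_eq]
  congr 1
  ext z
  rw [Q_eq F f hF, Q_eq F f hF]
  unfold Tsum
  rw [← Finset.sum_sub_distrib]
  refine Finset.sum_congr rfl (fun p _ => ?_)
  ring

theorem AQ_eq (F : Finset (ℤ × ℤ)) (f : ℤ → ℤ → ℝ)
    (hF : ∀ p : ℤ × ℤ, p ∉ F → f p.1 p.2 = 0) (η : ℤ → ℝ) :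
    AQ f η = Tsum F f (fun x y => if y ≠ x then 2 * (η (x + 1) - η (x - 1)) * η y else 0) := by
  unfold AQ
  refine HasSum.tsum_eq ?_
  refine (hasSum_T F f hF _).prod_fiberwise (fun x => ?_)
  have hs : Summable (fun y : ℤ => if y ≠ x then η y * f x y else 0) := by
    apply summable_of_ne_finset_zero (s := F.image Prod.snd)
    intro y hy
    have : f x y = 0 := hF (x, y) (fun h => hy (Finset.mem_image.2 ⟨_, h, rfl⟩))
    simp [this]
  have h := (hs.hasSum.mul_left 2).mul_left (η (x + 1) - η (x - 1))
  refine hs_congr h (fun y => ?_)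
  dsimp only
  split_ifs <;> ring

/-- Coefficient of the right-hand side. -/
noncomputable def KQ (η : ℤ → ℝ) (x y : ℤ) : ℝ := if x ≠ y then η x * η y else 0

theorem QR_eq (F : Finset (ℤ × ℤ)) (f : ℤ → ℤ → ℝ)
    (hF : ∀ p : ℤ × ℤ, p ∉ F → f p.1 p.2 = 0) (η : ℤ → ℝ) :
    Qfield (fun x y => discLap f x y + discA f x y) η
      = 2 * Tsum F f (fun x y => KQ η (x - (-1)) (y - 0))
        + 2 * Tsum F f (fun x y => KQ η (x - 0) (y - (-1)))
        - 4 * Tsum F f (KQ η) := by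
  unfold Qfield
  refine HasSum.tsum_eq ?_
  have h := (((hasSum_shift F f hF (KQ η) (-1) 0).mul_left 2).add
    ((hasSum_shift F f hF (KQ η) 0 (-1)).mul_left 2)).sub
    ((hasSum_T F f hF (KQ η)).mul_left 4)
  refine hs_congr h (fun p => ?_)
  unfold KQ discLap discA
  simp only [add_zero, ← sub_eq_add_neg]
  split_ifs <;> ring

theorem D_eq (F : Finset (ℤ × ℤ)) (f : ℤ → ℤ → ℝ)
    (hF : ∀ p : ℤ × ℤ, p ∉ F → f p.1 p.2 = 0) (η : ℤ → ℝ) :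
    Dterm f η
      = 2 * (Tsum F f (fun x y => if x - (-1) = y - 0 then η (x - (-1)) ^ 2 else 0)
          - Tsum F f (fun x y => if x - 0 = y - 1 then η (x - 0) ^ 2 else 0))
        + 4 * (Tsum F f (fun x y => if x - 0 = y - 1 then η (x - 0) * η (x - 0 + 1) else 0)
          - Tsum F f (fun x y => if x - 0 = y - 0 then η (x - 0) * η (x - 0 + 1) else 0)) := by
  unfold Dterm
  congr 2
  · refine HasSum.tsum_eq ?_
    have h := (hasSum_diag F f hF (fun x => η x ^ 2) (-1) 0).sub
      (hasSum_diag F f hF (fun x => η x ^ 2) 0 1)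
    refine hs_congr h (fun x => ?_)
    simp only [add_zero, ← sub_eq_add_neg]
    ring
  · refine HasSum.tsum_eq ?_
    have h := (hasSum_diag F f hF (fun x => η x * η (x + 1)) 0 1).sub
      (hasSum_diag F f hF (fun x => η x * η (x + 1)) 0 0)
    refine hs_congr h (fun x => ?_)
    simp only [add_zero]
    ring

theorem T_ext (F : Finset (ℤ × ℤ)) (f : ℤ → ℤ → ℝ) (hsym : ∀ x y : ℤ, f x y = f y x)
    (hF : ∀ p : ℤ × ℤ, p ∉ F → f p.1 p.2 = 0) (E : ℤ → ℤ → ℝ)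
    (hE : ∀ x y, E x y + E y x = 0) : Tsum F f E = 0 := by
  have h := T_sym F f hsym hF E
  have h2 : Tsum F f (fun x y => E y x) + Tsum F f E = 0 := by
    unfold Tsum
    rw [← Finset.sum_add_distrib]
    refine Finset.sum_eq_zero (fun p _ => ?_)
    rw [← add_mul, add_comm, hE, zero_mul]
  linarith

/-- For a symmetric, finitely supported `f : ℤ² → ℝ` and any `η : ℤ → ℝ`,
`S Q(f)(η) + A Q(f)(η) = Q((Δ + 𝒜) f)(η) + D(f)(η)`. -/
theorem stmt_19 (f : ℤ → ℤ → ℝ) (hsym : ∀ x y : ℤ, f x y = f y x)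
    (hfin : {p : ℤ × ℤ | f p.1 p.2 ≠ 0}.Finite) (η : ℤ → ℝ) :
    SQ f η + AQ f η =
      Qfield (fun x y => discLap f x y + discA f x y) η + Dterm f η := by
  set F := hfin.toFinset with hFdef
  have hF : ∀ p : ℤ × ℤ, p ∉ F → f p.1 p.2 = 0 := by
    intro p hp
    by_contra h
    exact hp (by simpa [hFdef] using h)
  rw [SQ_eq F f hF, AQ_eq F f hF, QR_eq F f hF, D_eq F f hF, ← sub_eq_zero]
  simp only [sub_zero, sub_neg_eq_add]
  let E : ℤ → ℤ → ℝ := fun x y =>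
    (KS η x y + (if y ≠ x then 2 * (η (x + 1) - η (x - 1)) * η y else 0))
    - ((2 * KQ η (x + 1) y + 2 * KQ η x (y + 1) - 4 * KQ η x y)
      + (2 * ((if x + 1 = y then η (x + 1) ^ 2 else 0) - (if x = y - 1 then η x ^ 2 else 0))
        + 4 * ((if x = y - 1 then η x * η (x + 1) else 0)
          - (if x = y then η x * η (x + 1) else 0))))
  have hE : ∀ x y, E x y + E y x = 0 := by
    intro x y
    simp only [E, KS, KQ]
    by_cases h0 : x = y
    · subst h0
      have e1 : ¬ (x = x - 1) := by omega
      simp [e1]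
      ring
    · have h0' : ¬ (y = x) := fun h => h0 h.symm
      by_cases h1 : y = x + 1
      · subst h1
        have e1 : ¬ (x + 1 = x - 1) := by omega
        have e2 : ¬ (x = x + 1 + 1) := by omega
        have e3 : ¬ (x + 1 + 1 = x) := by omega
        simp [e1, e2, e3]
        ring
      · by_cases h2 : x = y + 1
        · subst h2
          have e1 : ¬ (y + 1 = y - 1) := by omega
          have e2 : ¬ (y = y + 1 + 1) := by omega
          have e3 : ¬ (y + 1 + 1 = y) := by omega
          simp [e1, e2, e3]
          ring
        · have e1 : ¬ (x + 1 = y) := by omega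
          have e2 : ¬ (y + 1 = x) := by omega
          have e3 : ¬ (x = y - 1) := by omega
          have e4 : ¬ (y = x - 1) := by omega
          simp [e1, e2, e3, e4, h0, h0', h1, h2]
          ring
  have hT := T_ext F f hsym hF E hE
  refine Eq.trans ?_ hT
  simp only [E, Tsum, Finset.mul_sum, ← Finset.sum_add_distrib, ← Finset.sum_sub_distrib]
  refine Finset.sum_congr rfl (fun p _ => ?_)
  ring
end
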